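/- Let (R, I) be a graded pair of dimension d ≥ 2 and M a finitely generated graded R-module. Then the sequence {g_n(M_R,I)}_{n∈ℕ} is a uniformly convergent sequence of compactly supported continuous piecewise linear functions on [0,∞); equivalently, the sequence of step functions {f_n(M_R,I)}_{n∈ℕ} converges uniformly on [0,∞). -/

import Mathlib

open Filter MeasureTheory Topology

noncomputable section

/-- The `q`-th Frobenius bracket power `I^{[q]}` of an ideal `I`. -/
def Ideal.frobeniusPow {R : Type*} [CommSemiring R] (I : Ideal R) (q : ℕ) : Ideal R :=
  Ideal.span ((· ^ q) '' (I : Set R))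

/-- `dim_k` of the degree-`j` graded piece of `M ⧸ N`, for a graded `k`-module `M`
with grading `ℳ` and a `k`-submodule `N ≤ M`. -/
def gradedPieceLen (k : Type*) [Field k] {M : Type*} [AddCommGroup M] [Module k M]
    (ℳ : ℕ → Submodule k M) (N : Submodule k M) (j : ℕ) : ℕ :=
  Module.finrank k (↥(ℳ j) ⧸ (N.comap (ℳ j).subtype))

/-- The step function `f_n(M_R, I)` of a graded pair, for a graded module `M`. -/
def hkStep (k : Type*) [Field k] {R M : Type*} [CommRing R] [AddCommGroup M] [Module R M]
    [Module k M] [SMul k R] [IsScalarTower k R M]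
    (ℳ : ℕ → Submodule k M) (I : Ideal R) (d n₀ p n : ℕ) (x : ℝ) : ℝ :=
  (∑ i ∈ Finset.range n₀,
      (gradedPieceLen k ℳ ((I.frobeniusPow (p ^ n) • (⊤ : Submodule R M)).restrictScalars k)
        (⌊x * (p ^ n : ℕ)⌋₊ * n₀ + i) : ℝ)) / ((p : ℝ) ^ n) ^ (d - 1)

/-- The interpolated function `g_n(M_R, I)` of a graded pair. -/
def hkStepG (k : Type*) [Field k] {R M : Type*} [CommRing R] [AddCommGroup M] [Module R M]
    [Module k M] [SMul k R] [IsScalarTower k R M]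
    (ℳ : ℕ → Submodule k M) (I : Ideal R) (d n₀ p n : ℕ) (x : ℝ) : ℝ :=
  (1 - (x * (p ^ n : ℕ) - ⌊x * (p ^ n : ℕ)⌋₊)) *
      hkStep k ℳ I d n₀ p n ((⌊x * (p ^ n : ℕ)⌋₊ : ℝ) / (p ^ n : ℕ))
    + (x * (p ^ n : ℕ) - ⌊x * (p ^ n : ℕ)⌋₊) *
      hkStep k ℳ I d n₀ p n ((⌊x * (p ^ n : ℕ)⌋₊ + 1 : ℝ) / (p ^ n : ℕ))

/-! ### Negligible functions -/

/-- A function `u` of an exponent `q ≥ 1` and a degree `m` is negligible of order `D` when it is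
bounded by a constant multiple of `(|m| + q) ^ D`. -/
def Negligible (D : ℕ) (u : ℕ → ℤ → ℤ) : Prop :=
  ∃ C : ℤ, ∀ q : ℕ, 1 ≤ q → ∀ m : ℤ, |u q m| ≤ C * (|m| + q) ^ D

namespace Negligible

variable {D : ℕ} {u v : ℕ → ℤ → ℤ}

lemma mono (hv : Negligible D v) (h : ∀ q m, 1 ≤ q → |u q m| ≤ |v q m|) : Negligible D u := by
  obtain ⟨C, hC⟩ := hv
  exact ⟨C, fun q hq m => (h q m hq).trans (hC q hq m)⟩

lemma congr (hv : Negligible D v) (h : ∀ q m, 1 ≤ q → u q m = v q m) : Negligible D u :=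
  hv.mono fun q m hq => by rw [h q m hq]

lemma zero : Negligible D fun _ _ => 0 := ⟨0, by simp⟩

lemma add (hu : Negligible D u) (hv : Negligible D v) :
    Negligible D fun q m => u q m + v q m := by
  obtain ⟨C, hC⟩ := hu
  obtain ⟨C', hC'⟩ := hv
  refine ⟨C + C', fun q hq m => (abs_add_le _ _).trans ?_⟩
  rw [add_mul]
  exact add_le_add (hC q hq m) (hC' q hq m)

lemma neg (hu : Negligible D u) : Negligible D fun q m => -u q m :=
  hu.mono fun q m _ => by rw [abs_neg]

lemma sub (hu : Negligible D u) (hv : Negligible D v) :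
    Negligible D fun q m => u q m - v q m := by
  simpa only [sub_eq_add_neg] using hu.add hv.neg

lemma sum {ι : Type*} (s : Finset ι) {w : ι → ℕ → ℤ → ℤ} (h : ∀ i ∈ s, Negligible D (w i)) :
    Negligible D fun q m => ∑ i ∈ s, w i q m := by
  classical
  induction s using Finset.induction_on with
  | empty => simpa using zero
  | insert a s ha ih =>
    simp only [Finset.sum_insert ha]
    exact (h a (by simp)).add (ih fun i hi => h i (by simp [hi]))

lemma nonneg_const {C : ℤ} (h : ∀ q : ℕ, 1 ≤ q → ∀ m : ℤ, |u q m| ≤ C * (|m| + q) ^ D) :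
    0 ≤ C := by
  simpa using (abs_nonneg _).trans (h 1 le_rfl 0)

/-- Precomposition with an affine change of the degree and a rescaling of the exponent. -/
lemma comp (hu : Negligible D u) (a b c : ℤ) {e : ℕ} (he : 1 ≤ e) :
    Negligible D fun q m => u (e * q) (a * m + b * q + c) := by
  obtain ⟨C, hC⟩ := hu
  have hC0 := nonneg_const hC
  refine ⟨C * (|a| + |b| + |c| + e) ^ D, fun q hq m => (hC _ (by nlinarith) _).trans ?_⟩
  rw [mul_assoc, ← mul_pow]
  refine mul_le_mul_of_nonneg_left (pow_le_pow_left₀ (by positivity) ?_ _) hC0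
  have h1 : |a * m + b * q + c| ≤ |a| * |m| + |b| * q + |c| := by
    refine (abs_add_le _ _).trans (add_le_add ((abs_add_le _ _).trans ?_) le_rfl)
    rw [abs_mul, abs_mul, Nat.abs_cast]
  have h2 : (1 : ℤ) ≤ q := by exact_mod_cast hq
  have := abs_nonneg a
  have := abs_nonneg b
  have := abs_nonneg c
  have := abs_nonneg m
  have h3 : |c| ≤ |c| * q := by nlinarith
  push_cast
  nlinarith [mul_nonneg (abs_nonneg a) (by positivity : (0 : ℤ) ≤ q),
    mul_nonneg (abs_nonneg b) (abs_nonneg m), mul_nonneg (abs_nonneg c) (abs_nonneg m),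
    mul_nonneg (by positivity : (0 : ℤ) ≤ e) (abs_nonneg m)]

lemma shift (hu : Negligible D u) (b : ℤ) : Negligible D fun q m => u q (m - b) :=
  (hu.comp 1 0 (-b) le_rfl).congr fun q m _ => by simp [sub_eq_add_neg]

lemma shift_mul (hu : Negligible D u) (b : ℤ) : Negligible D fun q m => u q (m - q * b) :=
  (hu.comp 1 (-b) 0 le_rfl).congr fun q m _ => by
    simp only [one_mul, add_zero]; congr 1; ring

end Negligible

/-! ### Colengths of bracket powers, degree by degree -/

lemma Submodule.exists_sup_eq_finrank {k M : Type*} [Field k] [AddCommGroup M] [Module k M]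
    {W V : Submodule k M} (h : W ≤ V) [FiniteDimensional k V] :
    ∃ U : Submodule k M, W ⊔ U = V ∧ Module.finrank k U + Module.finrank k W =
      Module.finrank k V := by
  obtain ⟨U, hU⟩ := W.exists_isCompl
  refine ⟨U ⊓ V, ?_, ?_⟩
  · rw [← sup_inf_assoc_of_le U h, hU.sup_eq_top, top_inf_eq]
  · have : FiniteDimensional k W := Submodule.finiteDimensional_of_le h
    have : FiniteDimensional k (U ⊓ V : Submodule k M) :=
      Submodule.finiteDimensional_of_le inf_le_right
    have := Submodule.finrank_sup_add_finrank_inf_eq W (U ⊓ V)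
    rw [← sup_inf_assoc_of_le U h, hU.sup_eq_top, top_inf_eq, ← inf_assoc, hU.inf_eq_bot,
      bot_inf_eq, finrank_bot] at this
    omega

section Bracket

variable {k R M ι : Type*} [Field k] [CommRing R] [Algebra k R] [AddCommGroup M] [Module R M]
  [Module k M] [IsScalarTower k R M] [Fintype ι]

/-- The degree `m` part of `(f_i ^ q)_i • V`, for a graded family `V` and elements `f i` of
degree `δ i`. -/
def bracketPart (f : ι → R) (δ : ι → ℤ) (q : ℕ) (V : ℤ → Submodule k M) (m : ℤ) :
    Submodule k M :=
  ⨆ i, (V (m - q * δ i)).map (Algebra.lsmul k k M (f i ^ q))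

/-- The codimension of `bracketPart f δ q V m` in `V m`. -/
def bracketLen (f : ι → R) (δ : ι → ℤ) (q : ℕ) (V : ℤ → Submodule k M) (m : ℤ) : ℤ :=
  Module.finrank k (V m) - Module.finrank k (bracketPart f δ q V m)

/-- Homogeneous elements of the graded family `A` act on the graded family `V` with the expected
degrees. -/
def GradedAction (A : ℤ → Submodule k R) (V : ℤ → Submodule k M) : Prop :=
  ∀ ⦃a b : ℤ⦄ ⦃r : R⦄ ⦃v : M⦄, r ∈ A a → v ∈ V b → r • v ∈ V (a + b)

variable {f : ι → R} {δ : ι → ℤ} {q : ℕ} {V W : ℤ → Submodule k M} {m : ℤ}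

lemma mem_bracketPart {x : M} :
    x ∈ bracketPart f δ q V m ↔
      ∃ w : ι → M, (∀ i, w i ∈ V (m - q * δ i)) ∧ ∑ i, f i ^ q • w i = x := by
  classical
  constructor
  · intro hx
    refine Submodule.iSup_induction _ (motive := fun x => ∃ w : ι → M,
      (∀ i, w i ∈ V (m - q * δ i)) ∧ ∑ i, f i ^ q • w i = x) hx ?_ ?_ ?_
    · rintro i x ⟨v, hv, rfl⟩
      refine ⟨Pi.single i v, fun j => ?_, ?_⟩
      · rcases eq_or_ne j i with rfl | hj
        · simpa using hv
        · simp [Pi.single_eq_of_ne hj]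
      · rw [Finset.sum_eq_single i (fun j _ hj => by simp [Pi.single_eq_of_ne hj]) (by simp)]
        simp [-map_pow]
    · exact ⟨0, fun i => zero_mem _, by simp⟩
    · rintro x y ⟨w, hw, rfl⟩ ⟨w', hw', rfl⟩
      exact ⟨w + w', fun i => add_mem (hw i) (hw' i), by simp [smul_add, Finset.sum_add_distrib]⟩
  · rintro ⟨w, hw, rfl⟩
    exact Submodule.sum_mem _ fun i _ => Submodule.mem_iSup_of_mem i ⟨w i, hw i, rfl⟩

omit [Fintype ι] in
lemma bracketPart_mono (h : ∀ j, W j ≤ V j) : bracketPart f δ q W m ≤ bracketPart f δ q V m :=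
  iSup_mono fun _ => Submodule.map_mono (h _)

omit [Fintype ι] in
lemma bracketPart_le {A : ℤ → Submodule k R} (hf : ∀ i, f i ^ q ∈ A (q * δ i))
    (hV : GradedAction A V) : bracketPart f δ q V m ≤ V m := by
  refine iSup_le fun i => ?_
  rintro _ ⟨v, hv, rfl⟩
  simpa [-map_pow] using hV (hf i) hv

omit [Fintype ι] in
lemma bracketLen_nonneg {A : ℤ → Submodule k R} [FiniteDimensional k (V m)]
    (hf : ∀ i, f i ^ q ∈ A (q * δ i)) (hV : GradedAction A V) : 0 ≤ bracketLen f δ q V m := by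
  have := Submodule.finrank_mono (bracketPart_le (m := m) hf hV)
  rw [bracketLen]
  omega

omit [Fintype ι] in
lemma bracketLen_le : bracketLen f δ q V m ≤ Module.finrank k (V m) := by
  rw [bracketLen]
  omega

variable [∀ j, FiniteDimensional k (V j)]

instance : FiniteDimensional k (bracketPart f δ q V m) := by
  rw [bracketPart]
  infer_instance

/-- Passing to a graded subfamily changes the colength by a bounded number of values of the Hilbert
function of the quotient. -/
lemma abs_bracketLen_sub_le (h : ∀ j, W j ≤ V j) :
    |bracketLen f δ q V m - bracketLen f δ q W m| ≤
      ((Module.finrank k (V m) : ℤ) - Module.finrank k (W m)) +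
      ∑ i, ((Module.finrank k (V (m - q * δ i)) : ℤ) -
        Module.finrank k (W (m - q * δ i))) := by
  have : ∀ j, FiniteDimensional k (W j) := fun j => Submodule.finiteDimensional_of_le (h j)
  choose U hU hUr using fun j => Submodule.exists_sup_eq_finrank (h j)
  have : ∀ j, FiniteDimensional k (U j) := fun j =>
    Submodule.finiteDimensional_of_le (le_sup_right.trans (hU j).le)
  have hle := Submodule.finrank_mono (bracketPart_mono (f := f) (δ := δ) (q := q) (m := m) h)
  have hsup : bracketPart f δ q V m = bracketPart f δ q W m ⊔ bracketPart f δ q U m := by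
    simp only [bracketPart, ← iSup_sup_eq, ← Submodule.map_sup, hU]
  have hUle : ∀ s : Finset ι, Module.finrank k
      (↥(⨆ i ∈ s, (U (m - q * δ i)).map (Algebra.lsmul k k M (f i ^ q)))) ≤
      ∑ i ∈ s, Module.finrank k (U (m - q * δ i)) := by
    classical
    intro s
    induction s using Finset.induction_on with
    | empty => simp
    | insert a s ha ih =>
      rw [Finset.iSup_insert, Finset.sum_insert ha]
      exact (Submodule.finrank_add_le_finrank_add_finrank _ _).trans
        (add_le_add (Submodule.finrank_map_le _ _) ih)
  have hUniv : bracketPart f δ q U m =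
      ⨆ i ∈ Finset.univ, (U (m - q * δ i)).map (Algebra.lsmul k k M (f i ^ q)) := by
    simp only [bracketPart, Finset.mem_univ, iSup_pos]
  have h1 := hUle Finset.univ
  rw [← hUniv] at h1
  have h2 := Submodule.finrank_add_le_finrank_add_finrank
    (bracketPart f δ q W m) (bracketPart f δ q U m)
  rw [← hsup] at h2
  have h3 : (∑ i, ((Module.finrank k (V (m - q * δ i)) : ℤ) -
      Module.finrank k (W (m - q * δ i)))) =
      ((∑ i, Module.finrank k (U (m - q * δ i)) : ℕ) : ℤ) := by
    push_cast
    refine Finset.sum_congr rfl fun i _ => ?_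
    rw [← hUr]
    push_cast
    ring
  have h4 := Submodule.finrank_mono (h m)
  rw [h3, abs_le]
  unfold bracketLen
  constructor <;> omega

lemma Negligible.bracketLen_sub {D : ℕ} (h : ∀ j, W j ≤ V j)
    (hVW : Negligible D fun _ m => (Module.finrank k (V m) : ℤ) - Module.finrank k (W m)) :
    Negligible D fun q m => bracketLen f δ q V m - bracketLen f δ q W m := by
  refine (hVW.add (Negligible.sum Finset.univ fun i _ => hVW.shift_mul (δ i))).mono
    fun q m _ => ?_
  exact (abs_bracketLen_sub_le h).trans (le_abs_self _)

end Bracket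

section Comparison

variable {k R M M' ι : Type*} [Field k] [CommRing R] [Algebra k R]
  [AddCommGroup M] [Module R M] [Module k M] [IsScalarTower k R M]
  [AddCommGroup M'] [Module R M'] [Module k M'] [IsScalarTower k R M']
  {f : ι → R} {δ : ι → ℤ}

lemma Submodule.finrank_map_eq_of_forall {φ : M →ₗ[k] M'} {V : Submodule k M}
    (h : ∀ v ∈ V, φ v = 0 → v = 0) : Module.finrank k (V.map φ) = Module.finrank k V := by
  have : V.map φ = (φ.domRestrict V).range := by
    rw [LinearMap.range_domRestrict]
  rw [this]
  refine LinearMap.finrank_range_of_inj ((injective_iff_map_eq_zero _).2 ?_)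
  rintro ⟨v, hv⟩ h0
  exact Subtype.ext (h v hv h0)

lemma bracketPart_map (φ : M →ₗ[R] M') (V : ℤ → Submodule k M) (b : ℤ) (q : ℕ) (m : ℤ) :
    bracketPart f δ q (fun j => (V (j - b)).map (φ.restrictScalars k)) m =
      (bracketPart f δ q V (m - b)).map (φ.restrictScalars k) := by
  simp only [bracketPart, Submodule.map_iSup, ← Submodule.map_comp]
  refine iSup_congr fun i => ?_
  rw [sub_right_comm]
  congr 1
  ext v
  simp [-map_pow]

lemma bracketLen_map (φ : M →ₗ[R] M') {V : ℤ → Submodule k M} {b m : ℤ} {q : ℕ}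
    (hle : bracketPart f δ q V (m - b) ≤ V (m - b))
    (hφ : ∀ v ∈ V (m - b), φ v = 0 → v = 0) :
    bracketLen f δ q (fun j => (V (j - b)).map (φ.restrictScalars k)) m =
      bracketLen f δ q V (m - b) := by
  rw [bracketLen, bracketPart_map, bracketLen, Submodule.finrank_map_eq_of_forall hφ,
    Submodule.finrank_map_eq_of_forall fun v hv => hφ v (hle hv)]

lemma bracketLen_sup_of_disjoint {V W : ℤ → Submodule k M} {m : ℤ} {q : ℕ}
    [∀ j, FiniteDimensional k (V j)] [∀ j, FiniteDimensional k (W j)]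
    [Finite ι] (hV : bracketPart f δ q V m ≤ V m) (hW : bracketPart f δ q W m ≤ W m)
    (h : Disjoint (V m) (W m)) :
    bracketLen f δ q (fun j => V j ⊔ W j) m = bracketLen f δ q V m + bracketLen f δ q W m := by
  have := Fintype.ofFinite ι
  have hsup : bracketPart f δ q (fun j => V j ⊔ W j) m =
      bracketPart f δ q V m ⊔ bracketPart f δ q W m := by
    simp only [bracketPart, ← iSup_sup_eq, ← Submodule.map_sup]
  have h1 := Submodule.finrank_sup_add_finrank_inf_eq (V m) (W m)
  have h2 := Submodule.finrank_sup_add_finrank_inf_eq (bracketPart f δ q V m)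
    (bracketPart f δ q W m)
  rw [h.eq_bot, finrank_bot] at h1
  rw [(h.mono hV hW).eq_bot, finrank_bot] at h2
  rw [bracketLen, bracketLen, bracketLen, hsup]
  omega

/-- A graded family of subspaces of `R`, with finite-dimensional pieces, whose Hilbert function
changes by `O(m ^ D)` under shifts by degrees of nonzero elements, and with nonzero elements in two
consecutive degrees. -/
structure HilbertFamily (A : ℤ → Submodule k R) (D : ℕ) : Prop where
  one_mem : 1 ∈ A 0
  mul_mem : GradedAction A A
  finite : ∀ m, FiniteDimensional k (A m)
  growth : ∀ a, ∀ x ∈ A a, x ≠ 0 →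
    Negligible D fun _ m => (Module.finrank k (A m) : ℤ) - Module.finrank k (A (m - a))
  consecutive : ∃ N, (∃ x ∈ A N, x ≠ 0) ∧ ∃ y ∈ A (N + 1), y ≠ 0

/-- The graded family generated by finitely many elements of given degrees. -/
def genFamily (A : ℤ → Submodule k R) : List (ℤ × M) → ℤ → Submodule k M
  | [], _ => ⊥
  | (b, g) :: L, m =>
    genFamily A L m ⊔ (A (m - b)).map ((LinearMap.toSpanSingleton R M g).restrictScalars k)

namespace HilbertFamily

variable {A : ℤ → Submodule k R} {D : ℕ} (hA : HilbertFamily A D)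

include hA

lemma pow_mem {x : R} {a : ℤ} (hx : x ∈ A a) (q : ℕ) : x ^ q ∈ A (q * a) := by
  induction q with
  | zero => simpa using hA.one_mem
  | succ q ih =>
    have := hA.mul_mem ih hx
    rw [smul_eq_mul, ← pow_succ] at this
    convert this using 2
    push_cast
    ring

lemma gradedAction_genFamily (L : List (ℤ × M)) : GradedAction A (genFamily A L) := by
  induction L with
  | nil =>
    rintro a b r v - hv
    rw [genFamily, Submodule.mem_bot] at hv
    simp [hv]
  | cons c L ih =>
    obtain ⟨c, g⟩ := c
    intro a b r v hr hv
    obtain ⟨y, hy, z, ⟨s, hs, rfl⟩, rfl⟩ := Submodule.mem_sup.1 hv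
    rw [smul_add]
    refine Submodule.add_mem_sup (ih hr hy) ⟨r * s, ?_, by simp [mul_smul]⟩
    have := hA.mul_mem hr hs
    rw [← add_sub_assoc] at this
    exact this

lemma finite_genFamily (L : List (ℤ × M)) (m : ℤ) : FiniteDimensional k (genFamily A L m) := by
  have := hA.finite
  induction L with
  | nil => rw [genFamily]; infer_instance
  | cons c L ih => rw [genFamily]; infer_instance

variable [IsDomain R] [Fintype ι] (hf : ∀ i, f i ∈ A (δ i))

include hf

lemma negligible_sub_of_mem {a : ℤ} {x : R} (hx : x ∈ A a) (hx0 : x ≠ 0) :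
    Negligible D fun q m => bracketLen f δ q A m - bracketLen f δ q A (m - a) := by
  have := hA.finite
  have hinj : ∀ v : R, LinearMap.toSpanSingleton R R x v = 0 → v = 0 := fun v hv => by
    simpa [hx0] using hv
  refine (Negligible.bracketLen_sub (f := f) (δ := δ)
    (W := fun j => (A (j - a)).map ((LinearMap.toSpanSingleton R R x).restrictScalars k))
    (V := A) ?_ ?_).congr ?_
  · rintro j _ ⟨r, hr, rfl⟩
    have := hA.mul_mem hr hx
    rw [sub_add_cancel] at this
    simpa using this
  · refine (hA.growth a x hx hx0).congr fun q m _ => ?_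
    rw [Submodule.finrank_map_eq_of_forall fun v _ => hinj v]
  · intro q m _
    rw [bracketLen_map _ (bracketPart_le (fun i => hA.pow_mem (hf i) q) hA.mul_mem)
      fun v _ => hinj v]

lemma negligible_shift_one :
    Negligible D fun q m => bracketLen f δ q A m - bracketLen f δ q A (m - 1) := by
  obtain ⟨N, ⟨x, hx, hx0⟩, y, hy, hy0⟩ := hA.consecutive
  refine ((hA.negligible_sub_of_mem hf hy hy0).sub
    ((hA.negligible_sub_of_mem hf hx hx0).shift 1)).congr fun q m _ => ?_
  rw [show m - 1 - N = m - (N + 1) by ring]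
  ring

lemma negligible_shift (b : ℤ) :
    Negligible D fun q m => bracketLen f δ q A m - bracketLen f δ q A (m - b) := by
  have hnat : ∀ b : ℕ,
      Negligible D fun q m => bracketLen f δ q A m - bracketLen f δ q A (m - b) := by
    intro b
    induction b with
    | zero => exact Negligible.zero.congr fun q m _ => by simp
    | succ b ih =>
      refine (ih.add ((hA.negligible_shift_one hf).shift b)).congr fun q m _ => ?_
      push_cast
      rw [← sub_sub]
      ring
  obtain ⟨n, rfl | rfl⟩ := b.eq_nat_or_neg
  · exact hnat n
  · refine ((hnat n).shift (-n)).neg.congr fun q m _ => ?_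
    simp

/-- Up to negligible terms, the colengths of a finitely generated graded family are a multiple of
those of `A`. -/
theorem exists_negligible_sub_mul (L : List (ℤ × M)) :
    ∃ s : ℕ, Negligible D fun q m =>
      bracketLen f δ q (genFamily A L) m - s * bracketLen f δ q A m := by
  have := hA.finite
  have hbr : ∀ q m, bracketPart f δ q A m ≤ A m := fun q m =>
    bracketPart_le (fun i => hA.pow_mem (hf i) q) hA.mul_mem
  induction L with
  | nil =>
    refine ⟨0, Negligible.zero.congr fun q m _ => ?_⟩
    have h : bracketPart f δ q (genFamily A ([] : List (ℤ × M))) m = ⊥ := by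
      simp [bracketPart, genFamily]
    rw [bracketLen, h, genFamily]
    simp
  | cons c L ih =>
    obtain ⟨b, g⟩ := c
    obtain ⟨s, hs⟩ := ih
    have hfin := hA.finite_genFamily L
    set φ := LinearMap.toSpanSingleton R M g
    set V := genFamily A L with hV
    set U : ℤ → Submodule k M := fun m => (A (m - b)).map (φ.restrictScalars k) with hU
    have hcons : genFamily A ((b, g) :: L) = fun m => V m ⊔ U m := rfl
    have hVact : GradedAction A V := hA.gradedAction_genFamily L
    have hUact : GradedAction A U := by
      rintro a c r _ hr ⟨v, hv, rfl⟩
      refine ⟨r • v, ?_, φ.map_smul r v⟩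
      have := hA.mul_mem hr hv
      rwa [← add_sub_assoc] at this
    rw [hcons]
    by_cases hfree : ∀ m, ∀ r ∈ A (m - b), φ r ∈ V m → r = 0
    · refine ⟨s + 1, (hs.sub (hA.negligible_shift hf b)).congr fun q m _ => ?_⟩
      rw [bracketLen_sup_of_disjoint
        (bracketPart_le (fun i => hA.pow_mem (hf i) q) hVact)
        (bracketPart_le (fun i => hA.pow_mem (hf i) q) hUact), hU,
        bracketLen_map φ (hbr q _) fun v hv h0 => hfree m v hv (h0 ▸ zero_mem _)]
      · push_cast
        ring
      · rw [Submodule.disjoint_def]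
        rintro _ hv ⟨r, hr, rfl⟩
        rw [hfree m r hr hv, map_zero]
    · push Not at hfree
      obtain ⟨m₀, r, hr, hrV, hr0⟩ := hfree
      refine ⟨s, (hs.add (Negligible.bracketLen_sub (fun j => le_sup_left) ?_)).congr
        (v := fun q m => _) fun q m _ => (by rw [sub_add_eq_add_sub, add_sub_cancel])⟩
      refine ((hA.growth _ r hr hr0).shift b).mono fun q m _ => ?_
      set P : Submodule k M :=
        ((A (m - b - (m₀ - b))).map ((LinearMap.toSpanSingleton R R r).restrictScalars k)).map
          (φ.restrictScalars k)
      have hPV : P ≤ V m := by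
        rintro _ ⟨_, ⟨t, ht, rfl⟩, rfl⟩
        have := hVact ht hrV
        rw [sub_sub_sub_cancel_right, sub_add_cancel] at this
        simpa [mul_smul, φ] using this
      have hTA : (A (m - b - (m₀ - b))).map
          ((LinearMap.toSpanSingleton R R r).restrictScalars k) ≤ A (m - b) := by
        rintro _ ⟨t, ht, rfl⟩
        have := hA.mul_mem ht hr
        rw [sub_add_cancel] at this
        simpa using this
      obtain ⟨T, hT, hTr⟩ := Submodule.exists_sup_eq_finrank hTA
      have : FiniteDimensional k T :=
        Submodule.finiteDimensional_of_le (le_sup_right.trans hT.le)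
      rw [Submodule.finrank_map_eq_of_forall
        (fun v _ hv => by simpa [hr0] using hv)] at hTr
      have hsup : V m ⊔ U m = V m ⊔ T.map (φ.restrictScalars k) := by
        rw [hU]
        simp only
        rw [← hT, Submodule.map_sup, ← sup_assoc, sup_eq_left.2 hPV]
      have h1 := Submodule.finrank_add_le_finrank_add_finrank (V m)
        (T.map (φ.restrictScalars k))
      have h2 := Submodule.finrank_map_le (φ.restrictScalars k) T
      have h3 := Submodule.finrank_mono (le_sup_left : V m ≤ V m ⊔ U m)
      rw [← hsup] at h1
      rw [abs_of_nonneg (by omega), abs_of_nonneg (by omega)]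
      omega

end HilbertFamily

end Comparison

/-! ### Extending a grading by zero to negative degrees -/

section Extend

variable {k M : Type*} [Field k] [AddCommGroup M] [Module k M]

/-- Extension of a graded family by zero to negative degrees. -/
def extendInt (ℳ : ℕ → Submodule k M) (z : ℤ) : Submodule k M :=
  if 0 ≤ z then ℳ z.toNat else ⊥

lemma extendInt_natCast (ℳ : ℕ → Submodule k M) (n : ℕ) : extendInt ℳ n = ℳ n := by
  simp [extendInt]

lemma extendInt_of_neg (ℳ : ℕ → Submodule k M) {z : ℤ} (hz : z < 0) : extendInt ℳ z = ⊥ := by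
  simp [extendInt, hz]

variable (ℳ : ℕ → Submodule k M) [DirectSum.Decomposition ℳ]

/-- The projection to the homogeneous component of integral degree `z`. -/
def projInt (z : ℤ) : M →+ M where
  toFun x := if 0 ≤ z then (DirectSum.decompose ℳ x z.toNat : M) else 0
  map_zero' := by simp
  map_add' x y := by split_ifs <;> simp [DirectSum.decompose_add]

lemma projInt_natCast (n : ℕ) (x : M) : projInt ℳ n x = DirectSum.decompose ℳ x n := by
  simp [projInt]

lemma projInt_of_neg {z : ℤ} (hz : z < 0) (x : M) : projInt ℳ z x = 0 := by
  simp [projInt, hz]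

lemma projInt_mem (z : ℤ) (x : M) : projInt ℳ z x ∈ extendInt ℳ z := by
  rcases lt_or_ge z 0 with hz | hz
  · simp [projInt_of_neg ℳ hz]
  · lift z to ℕ using hz
    rw [projInt_natCast, extendInt_natCast]
    exact SetLike.coe_mem _

variable {ℳ}

lemma projInt_of_mem {z : ℤ} {x : M} (hx : x ∈ extendInt ℳ z) : projInt ℳ z x = x := by
  rcases lt_or_ge z 0 with hz | hz
  · rw [extendInt_of_neg _ hz, Submodule.mem_bot] at hx
    simp [hx]
  · lift z to ℕ using hz
    rw [extendInt_natCast] at hx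
    rw [projInt_natCast, DirectSum.decompose_of_mem_same ℳ hx]

lemma projInt_of_mem_ne {z w : ℤ} {x : M} (hx : x ∈ extendInt ℳ z) (h : z ≠ w) :
    projInt ℳ w x = 0 := by
  rcases lt_or_ge w 0 with hw | hw
  · exact projInt_of_neg ℳ hw x
  rcases lt_or_ge z 0 with hz | hz
  · rw [extendInt_of_neg _ hz, Submodule.mem_bot] at hx
    simp [hx]
  · lift z to ℕ using hz
    lift w to ℕ using hw
    rw [extendInt_natCast] at hx
    rw [projInt_natCast, DirectSum.decompose_of_mem_ne ℳ hx (by exact_mod_cast h)]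

lemma exists_projInt_eq_zero (ℳ : ℕ → Submodule k M) [DirectSum.Decomposition ℳ] (x : M) :
    ∃ N : ℕ, ∀ z : ℤ, N ≤ z → projInt ℳ z x = 0 := by
  classical
  refine ⟨(DirectSum.decompose ℳ x).support.sup id + 1, fun z hz => ?_⟩
  lift z to ℕ using by omega
  rw [projInt_natCast]
  by_contra h
  have : z ∈ (DirectSum.decompose ℳ x).support := by
    rw [DFinsupp.mem_support_iff]
    exact fun h0 => h (by rw [h0]; rfl)
  have := Finset.le_sup (f := id) this
  simp only [id] at this
  omega

lemma sum_projInt {x : M} {N : ℕ} (hN : ∀ z : ℤ, N ≤ z → projInt ℳ z x = 0) :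
    ∑ j ∈ Finset.range N, projInt ℳ j x = x := by
  classical
  conv_rhs => rw [← DirectSum.sum_support_decompose ℳ x]
  simp only [projInt_natCast]
  symm
  refine Finset.sum_subset (fun j hj => ?_) fun j _ hj => ?_
  · rw [DFinsupp.mem_support_iff] at hj
    rw [Finset.mem_range]
    by_contra hlt
    refine hj (Subtype.ext ?_)
    rw [← projInt_natCast, hN j (by omega)]
    rfl
  · rw [DFinsupp.mem_support_iff, not_not] at hj
    rw [hj]
    rfl

end Extend

section GradedModule

variable {k R M : Type*} [Field k] [CommRing R] [Algebra k R] [AddCommGroup M] [Module R M]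
  [Module k M] [IsScalarTower k R M]
  {𝒜 : ℕ → Submodule k R} [GradedAlgebra 𝒜]
  {ℳ : ℕ → Submodule k M} [DirectSum.Decomposition ℳ] [SetLike.GradedSMul 𝒜 ℳ]

omit [IsScalarTower k R M] [GradedAlgebra 𝒜] [DirectSum.Decomposition ℳ] in
lemma gradedAction_extendInt : GradedAction (extendInt 𝒜) (extendInt ℳ) := by
  intro a b r v hr hv
  rcases lt_or_ge a 0 with ha | ha
  · rw [extendInt_of_neg _ ha, Submodule.mem_bot] at hr
    simp [hr]
  rcases lt_or_ge b 0 with hb | hb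
  · rw [extendInt_of_neg _ hb, Submodule.mem_bot] at hv
    simp [hv]
  lift a to ℕ using ha
  lift b to ℕ using hb
  rw [extendInt_natCast] at hr hv
  rw [← Nat.cast_add, extendInt_natCast]
  exact SetLike.GradedSMul.smul_mem hr hv

omit [IsScalarTower k R M] [GradedAlgebra 𝒜] in
lemma projInt_smul {a : ℤ} {r : R} (hr : r ∈ extendInt 𝒜 a) (z : ℤ) (x : M) :
    projInt ℳ z (r • x) = r • projInt ℳ (z - a) x := by
  obtain ⟨N, hN⟩ := exists_projInt_eq_zero ℳ x
  have key : ∀ j : ℤ, projInt ℳ z (r • projInt ℳ j x) =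
      r • projInt ℳ (z - a) (projInt ℳ j x) := by
    intro j
    have hj := projInt_mem ℳ j x
    have hrj := gradedAction_extendInt hr hj
    by_cases h : a + j = z
    · subst h
      rw [projInt_of_mem hrj, add_sub_cancel_left, projInt_of_mem hj]
    · rw [projInt_of_mem_ne hrj h, projInt_of_mem_ne hj (by omega), smul_zero]
  conv_lhs => rw [← sum_projInt hN]
  conv_rhs => rw [← sum_projInt hN]
  rw [Finset.smul_sum, map_sum, map_sum, Finset.smul_sum]
  exact Finset.sum_congr rfl fun j _ => key j

omit [IsScalarTower k R M] [GradedAlgebra 𝒜] in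
/-- A homogeneous element of `(f_i) M` is a combination of the `f_i` with homogeneous coefficients
of the expected degrees. -/
lemma exists_sum_smul_of_mem_span_smul {ι : Type*} [Fintype ι] {f : ι → R} {δ : ι → ℤ}
    (hf : ∀ i, f i ∈ extendInt 𝒜 (δ i)) {n : ℤ} {u : M} (hu : u ∈ extendInt ℳ n)
    (h : u ∈ Ideal.span (Set.range f) • (⊤ : Submodule R M)) :
    ∃ w : ι → M, (∀ i, w i ∈ extendInt ℳ (n - δ i)) ∧ ∑ i, f i • w i = u := by
  have h1 : ∃ y : ι → M, ∑ i, f i • y i = u := by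
    clear hu
    induction h using Submodule.smul_induction_on' with
    | smul r hr y hy =>
      obtain ⟨c, rfl⟩ := Ideal.mem_span_range_iff_exists_fun.1 hr
      refine ⟨fun i => c i • y, ?_⟩
      rw [Finset.sum_smul]
      exact Finset.sum_congr rfl fun i _ => by rw [smul_smul, mul_comm]
    | add x hx y hy hx' hy' =>
      obtain ⟨c, rfl⟩ := hx'
      obtain ⟨c', rfl⟩ := hy'
      exact ⟨c + c', by simp [smul_add, Finset.sum_add_distrib]⟩
  obtain ⟨y, rfl⟩ := h1
  refine ⟨fun i => projInt ℳ (n - δ i) (y i), fun i => projInt_mem _ _ _, ?_⟩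
  conv_rhs => rw [← projInt_of_mem hu, map_sum]
  exact Finset.sum_congr rfl fun i _ => (projInt_smul (hf i) _ _).symm

omit [IsScalarTower k R M] [DirectSum.Decomposition ℳ] [SetLike.GradedSMul 𝒜 ℳ] in
lemma projInt_mem_of_isHomogeneous {J : Ideal R} (hJ : J.IsHomogeneous 𝒜) {x : R} (hx : x ∈ J)
    (z : ℤ) : projInt 𝒜 z x ∈ J := by
  rcases lt_or_ge z 0 with hz | hz
  · simp [projInt_of_neg 𝒜 hz]
  · lift z to ℕ using hz
    rw [projInt_natCast]
    exact hJ z hx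

end GradedModule

section Generators

variable {k R : Type*} [Field k] [CommRing R] [Algebra k R] [IsNoetherianRing R]
  {𝒜 : ℕ → Submodule k R} [GradedAlgebra 𝒜]

lemma finiteDimensional_extendInt (h𝒜0 : 𝒜 0 ≤ Submodule.span k {1}) (z : ℤ) :
    FiniteDimensional k (extendInt 𝒜 z) := by
  rcases lt_or_ge z 0 with hz | hz
  · rw [extendInt_of_neg _ hz]
    infer_instance
  lift z to ℕ using hz
  rw [extendInt_natCast]
  obtain ⟨t, ht, hspan⟩ := (Submodule.fg_span_iff_fg_span_finset_subset (R := R)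
    {x : R | ∃ n : ℕ, 0 < n ∧ x ∈ 𝒜 n}).1 (IsNoetherian.noetherian _)
  choose δ hδ0 hδ using fun x : t => ht x.2
  induction z using Nat.strong_induction_on with
  | _ n ih =>
  rcases Nat.eq_zero_or_pos n with rfl | hn
  · exact Submodule.finiteDimensional_of_le h𝒜0
  have hfin : ∀ x : t, FiniteDimensional k (extendInt 𝒜 (n - δ x)) := by
    intro x
    rcases lt_or_ge ((n : ℤ) - δ x) 0 with hz | hz
    · rw [extendInt_of_neg _ hz]
      infer_instance
    · have h1 : (n : ℤ) - δ x = (n - δ x : ℕ) := by omega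
      have := hδ0 x
      rw [h1, extendInt_natCast]
      exact ih _ (by omega)
  have hle : 𝒜 n ≤
      ⨆ x : t, (extendInt 𝒜 (n - δ x)).map (Algebra.lsmul k k R (x : R)) := by
    intro u hu
    have hu' : u ∈ extendInt 𝒜 n := by rwa [extendInt_natCast]
    have humem : u ∈ Ideal.span (Set.range ((↑) : t → R)) • (⊤ : Submodule R R) := by
      rw [Subtype.range_coe_subtype, smul_eq_mul, Ideal.mul_top]
      change u ∈ Submodule.span R (t : Set R)
      rw [← hspan]
      exact Submodule.subset_span ⟨n, hn, hu⟩
    obtain ⟨w, hw, rfl⟩ := exists_sum_smul_of_mem_span_smul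
      (δ := fun x => (δ x : ℤ)) (fun x => by rw [extendInt_natCast]; exact hδ x) hu' humem
    exact Submodule.sum_mem _ fun x _ => Submodule.mem_iSup_of_mem x ⟨w x, hw x, rfl⟩
  exact Submodule.finiteDimensional_of_le hle

end Generators

/-! ### Growth of Hilbert functions -/

section Growth

variable {k R : Type*} [Field k] [CommRing R] [Algebra k R] (𝒜 : ℕ → Submodule k R)

/-- The Hilbert function of `R ⧸ J`. -/
def hilb (J : Ideal R) (m : ℤ) : ℤ :=
  Module.finrank k (extendInt 𝒜 m) -
    Module.finrank k (extendInt 𝒜 m ⊓ J.restrictScalars k : Submodule k R)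

/-- Polynomial growth of the kind expected of Hilbert functions in dimension at most `e`. -/
def HilbertGrowth : ℕ → (ℤ → ℤ) → Prop
  | 0, h => ∃ N : ℤ, ∀ m, N ≤ m → h m = 0
  | e + 1, h => ∃ C : ℤ, ∀ m, h m ≤ C * (|m| + 1) ^ e

variable {𝒜} [GradedAlgebra 𝒜] [∀ z, FiniteDimensional k (extendInt 𝒜 z)]

omit [GradedAlgebra 𝒜] in
lemma hilb_nonneg (J : Ideal R) (m : ℤ) : 0 ≤ hilb 𝒜 J m := by
  have := Submodule.finrank_mono
    (inf_le_left : extendInt 𝒜 m ⊓ J.restrictScalars k ≤ extendInt 𝒜 m)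
  rw [hilb]
  omega

omit [GradedAlgebra 𝒜] [∀ z, FiniteDimensional k (extendInt 𝒜 z)] in
lemma hilb_eq_zero {J : Ideal R} {m : ℤ} (h : ∀ x ∈ extendInt 𝒜 m, x ∈ J) :
    hilb 𝒜 J m = 0 := by
  rw [hilb, inf_eq_left.2 h, sub_self]

omit [GradedAlgebra 𝒜] [∀ z, FiniteDimensional k (extendInt 𝒜 z)] in
lemma hilb_of_neg {J : Ideal R} {m : ℤ} (hm : m < 0) : hilb 𝒜 J m = 0 := by
  refine hilb_eq_zero fun x hx => ?_
  rw [extendInt_of_neg _ hm, Submodule.mem_bot] at hx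
  simp [hx]

lemma hilb_le_add {J K : Ideal R} (hJ : J.IsHomogeneous 𝒜) {α : ℤ} {a : R}
    (ha : a ∈ extendInt 𝒜 α) (hK : ∀ r ∈ K, a * r ∈ J) (m : ℤ) :
    hilb 𝒜 J m ≤ hilb 𝒜 (J ⊔ Ideal.span {a}) m + hilb 𝒜 K (m - α) := by
  obtain ⟨U, hU, hUr⟩ := Submodule.exists_sup_eq_finrank
    (inf_le_left : extendInt 𝒜 (m - α) ⊓ K.restrictScalars k ≤ _)
  have : FiniteDimensional k U := Submodule.finiteDimensional_of_le (le_sup_right.trans hU.le)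
  have hle : extendInt 𝒜 m ⊓ (J ⊔ Ideal.span {a}).restrictScalars k ≤
      (extendInt 𝒜 m ⊓ J.restrictScalars k) ⊔ U.map (Algebra.lsmul k k R a) := by
    rintro x ⟨hx, hx'⟩
    obtain ⟨j, hj, y, hy, hjy⟩ := Submodule.mem_sup.1 hx'
    obtain ⟨c, rfl⟩ := Ideal.mem_span_singleton'.1 hy
    have hx1 : projInt 𝒜 m j + a * projInt 𝒜 (m - α) c = x := by
      rw [← projInt_of_mem hx, ← hjy, map_add, mul_comm c a, ← smul_eq_mul a c,
        projInt_smul ha, smul_eq_mul]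
    have hc := projInt_mem 𝒜 (m - α) c
    rw [← hU] at hc
    obtain ⟨s, hs, t, ht, hst⟩ := Submodule.mem_sup.1 hc
    rw [← hst, mul_add, ← add_assoc] at hx1
    rw [← hx1]
    refine Submodule.add_mem_sup ⟨add_mem (projInt_mem 𝒜 m j) ?_, add_mem
      (projInt_mem_of_isHomogeneous hJ hj m) (hK s hs.2)⟩ ⟨t, ht, rfl⟩
    have := gradedAction_extendInt (ℳ := 𝒜) ha hs.1
    rwa [add_sub_cancel] at this
  have h1 := Submodule.finrank_mono hle
  have h2 := Submodule.finrank_add_le_finrank_add_finrank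
    (extendInt 𝒜 m ⊓ J.restrictScalars k) (U.map (Algebra.lsmul k k R a))
  have h3 := Submodule.finrank_map_le (Algebra.lsmul k k R a) U
  simp only [hilb]
  omega

lemma HilbertGrowth.add {e : ℕ} {h h₁ h₂ : ℤ → ℤ} {b : ℤ} (h0 : ∀ m, 0 ≤ h m)
    (hle : ∀ m, h m ≤ h₁ m + h₂ (m - b))
    (hg₁ : HilbertGrowth e h₁) (hg₂ : HilbertGrowth e h₂) : HilbertGrowth e h := by
  cases e with
  | zero =>
    obtain ⟨N₁, hN₁⟩ := hg₁
    obtain ⟨N₂, hN₂⟩ := hg₂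
    refine ⟨max N₁ (N₂ + b), fun m hm => le_antisymm ((hle m).trans ?_) (h0 m)⟩
    rw [max_le_iff] at hm
    rw [hN₁ m hm.1, hN₂ (m - b) (by omega), add_zero]
  | succ e =>
    obtain ⟨C₁, hC₁⟩ := hg₁
    obtain ⟨C₂, hC₂⟩ := hg₂
    refine ⟨|C₁| + |C₂| * (1 + |b|) ^ e, fun m => (hle m).trans ?_⟩
    rw [add_mul, mul_assoc, ← mul_pow]
    refine add_le_add ((hC₁ m).trans ?_) ((hC₂ _).trans ?_)
    · exact mul_le_mul_of_nonneg_right (le_abs_self _) (by positivity)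
    · refine mul_le_mul (le_abs_self _) (pow_le_pow_left₀ (by positivity) ?_ _) (by positivity)
        (by positivity)
      have := abs_sub m b
      nlinarith [abs_nonneg b, abs_nonneg m]

lemma HilbertGrowth.of_recursion {e : ℕ} {h h' : ℤ → ℤ} {a : ℤ} (ha : 0 < a)
    (h0 : ∀ m < 0, h m = 0) (h0' : ∀ m, 0 ≤ h' m) (hle : ∀ m, h m ≤ h' m + h (m - a))
    (hg : HilbertGrowth e h') : HilbertGrowth (e + 1) h := by
  have hsum : ∀ n : ℕ, h n ≤ ∑ j ∈ Finset.range (n + 1), h' j := by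
    intro n
    induction n using Nat.strong_induction_on with
    | _ n ih =>
    refine (hle n).trans ?_
    rw [Finset.sum_range_succ, add_comm]
    refine add_le_add ?_ le_rfl
    rcases lt_or_ge ((n : ℤ) - a) 0 with hneg | hpos
    · rw [h0 _ hneg]
      exact Finset.sum_nonneg fun j _ => h0' j
    · obtain ⟨l, hl⟩ := Int.eq_ofNat_of_zero_le hpos
      rw [hl]
      refine (ih l (by omega)).trans
        (Finset.sum_le_sum_of_subset_of_nonneg ?_ fun j _ _ => h0' j)
      intro j hj
      rw [Finset.mem_range] at hj ⊢
      omega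
  suffices h : ∃ C : ℤ, 0 ≤ C ∧ ∀ n : ℕ, ∑ j ∈ Finset.range (n + 1), h' j ≤ C * (n + 1) ^ e by
    obtain ⟨C, hC0, hC⟩ := h
    refine ⟨C, fun m => ?_⟩
    rcases lt_or_ge m 0 with hm | hm
    · rw [h0 m hm]
      positivity
    · lift m to ℕ using hm
      rw [Nat.abs_cast]
      exact (hsum m).trans (hC m)
  cases e with
  | zero =>
    obtain ⟨N, hN⟩ := hg
    refine ⟨∑ j ∈ Finset.range N.toNat, h' j, Finset.sum_nonneg fun j _ => h0' j, fun n => ?_⟩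
    rw [pow_zero, mul_one]
    rw [← Finset.sum_filter_ne_zero]
    refine Finset.sum_le_sum_of_subset_of_nonneg (fun j hj => ?_) fun j _ _ => h0' j
    rw [Finset.mem_range]
    by_contra hlt
    exact (Finset.mem_filter.1 hj).2 (hN j (by omega))
  | succ e =>
    obtain ⟨C, hC⟩ := hg
    refine ⟨|C|, abs_nonneg C, fun n => ?_⟩
    calc ∑ j ∈ Finset.range (n + 1), h' j
        ≤ ∑ _j ∈ Finset.range (n + 1), |C| * ((n : ℤ) + 1) ^ e := by
          refine Finset.sum_le_sum fun j hj => (hC j).trans ?_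
          rw [Finset.mem_range] at hj
          refine mul_le_mul (le_abs_self _) (pow_le_pow_left₀ (by positivity) ?_ _)
            (by positivity) (by positivity)
          rw [Nat.abs_cast]
          omega
      _ = |C| * ((n : ℤ) + 1) ^ (e + 1) := by
          rw [Finset.sum_const, Finset.card_range, nsmul_eq_mul]
          push_cast
          ring

lemma ringKrullDim_quotient_sup_span_add_one_le {J : Ideal R} [J.IsPrime] {a : R} (ha : a ∉ J) :
    ringKrullDim (R ⧸ J ⊔ Ideal.span {a}) + 1 ≤ ringKrullDim (R ⧸ J) := by
  have h := ringKrullDim_quotient_succ_le_of_nonZeroDivisor (r := Ideal.Quotient.mk J a)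
    (mem_nonZeroDivisors_of_ne_zero (by rwa [Ne, Ideal.Quotient.eq_zero_iff_mem]))
  rwa [← Set.image_singleton, ← Ideal.map_span,
    ringKrullDim_eq_of_ringEquiv (DoubleQuot.quotQuotEquivQuotSup _ _)] at h

theorem hilbertGrowth_hilb [IsNoetherianRing R] (J : Ideal R) (hJ : J.IsHomogeneous 𝒜) (e : ℕ)
    (he : ringKrullDim (R ⧸ J) ≤ e) : HilbertGrowth e (hilb 𝒜 J) := by
  induction J using WellFoundedGT.induction generalizing e with
  | ind J ih =>
  have hzero : (∀ m > 0, hilb 𝒜 J m = 0) → HilbertGrowth e (hilb 𝒜 J) := by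
    intro h
    cases e with
    | zero => exact ⟨1, fun m hm => h m (by omega)⟩
    | succ e =>
      refine ⟨hilb 𝒜 J 0, fun m => ?_⟩
      have h0 := hilb_nonneg (𝒜 := 𝒜) J 0
      rcases lt_trichotomy m 0 with hm | rfl | hm
      · rw [hilb_of_neg hm]
        positivity
      · simp
      · rw [h m hm]
        positivity
  by_cases hprime : J.IsPrime
  · by_cases hirr : ∀ m > 0, ∀ x ∈ extendInt 𝒜 m, x ∈ J
    · exact hzero fun m hm => hilb_eq_zero (hirr m hm)
    push Not at hirr
    obtain ⟨a, ha, θ, hθ, hθJ⟩ := hirr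
    have hdim := (ringKrullDim_quotient_sup_span_add_one_le hθJ).trans he
    have hJθ : (J ⊔ Ideal.span {θ}).IsHomogeneous 𝒜 := by
      refine hJ.sup (Ideal.homogeneous_span 𝒜 _ ?_)
      rintro x rfl
      lift a to ℕ using ha.le
      exact ⟨a, by rwa [extendInt_natCast] at hθ⟩
    have hlt : J < J ⊔ Ideal.span {θ} := by
      refine lt_of_le_of_ne le_sup_left fun h => hθJ ?_
      rw [h]
      exact Ideal.mem_sup_right (Ideal.mem_span_singleton_self θ)
    have hne : J ⊔ Ideal.span {θ} ≠ ⊤ := by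
      intro htop
      refine hprime.ne_top ((Ideal.eq_top_iff_one J).2 ?_)
      have h1 : (1 : R) ∈ J ⊔ Ideal.span {θ} := htop ▸ Submodule.mem_top
      obtain ⟨j, hj, y, hy, hjy⟩ := Submodule.mem_sup.1 h1
      obtain ⟨c, rfl⟩ := Ideal.mem_span_singleton'.1 hy
      have hone : (1 : R) ∈ extendInt 𝒜 0 := by
        rw [← Nat.cast_zero, extendInt_natCast]
        exact SetLike.GradedOne.one_mem
      rw [← projInt_of_mem hone, ← hjy, map_add, mul_comm, ← smul_eq_mul θ c, projInt_smul hθ,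
        projInt_of_neg 𝒜 (show (0 : ℤ) - a < 0 by omega), smul_zero, add_zero]
      exact projInt_mem_of_isHomogeneous hJ hj 0
    have : Nontrivial (R ⧸ J ⊔ Ideal.span {θ}) := Ideal.Quotient.nontrivial_iff.2 hne
    cases e with
    | zero =>
      exfalso
      have h0 : (0 : WithBot ℕ∞) ≤ ringKrullDim (R ⧸ J ⊔ Ideal.span {θ}) :=
        ringKrullDim_nonneg_of_nontrivial
      have := (add_le_add_left h0 1).trans hdim
      norm_num at this
    | succ e =>
      refine HilbertGrowth.of_recursion ha (fun m hm => hilb_of_neg hm)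
        (fun m => hilb_nonneg _ m) (hilb_le_add hJ hθ fun r hr => J.mul_mem_left _ hr)
        (ih _ hlt hJθ e ?_)
      push_cast at hdim
      exact (ENat.WithBot.add_le_add_one_right_iff).1 hdim
  by_cases htop : J = ⊤
  · exact hzero fun m _ => hilb_eq_zero fun x _ => htop ▸ Submodule.mem_top
  have hex : ∃ x y : R, SetLike.IsHomogeneousElem 𝒜 x ∧ SetLike.IsHomogeneousElem 𝒜 y ∧
      x * y ∈ J ∧ x ∉ J ∧ y ∉ J := by
    by_contra! h
    refine hprime (hJ.isPrime_of_homogeneous_mem_or_mem htop fun {x y} hx hy hxy => ?_)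
    by_contra! h'
    exact h'.2 (h x y hx hy hxy h'.1)
  obtain ⟨x, y, ⟨α, hx⟩, ⟨β, hy⟩, hxy, hxJ, hyJ⟩ := hex
  have hstep : ∀ z : R, z ∉ J → (∃ α, z ∈ 𝒜 α) →
      HilbertGrowth e (hilb 𝒜 (J ⊔ Ideal.span {z})) := by
    intro z hz hhom
    refine ih _ (lt_of_le_of_ne le_sup_left fun h => hz ?_)
      (hJ.sup (Ideal.homogeneous_span 𝒜 _ ?_)) e
      ((ringKrullDim_le_of_surjective (Ideal.Quotient.factor le_sup_left)
        (Ideal.Quotient.factor_surjective _)).trans he)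
    · rw [h]
      exact Ideal.mem_sup_right (Ideal.mem_span_singleton_self z)
    · rintro _ rfl
      exact hhom
  refine HilbertGrowth.add (fun m => hilb_nonneg J m)
    (hilb_le_add hJ (α := α) (by rwa [extendInt_natCast]) ?_)
    (hstep x hxJ ⟨α, hx⟩) (hstep y hyJ ⟨β, hy⟩)
  intro r hr
  obtain ⟨j, hj, w, hw, rfl⟩ := Submodule.mem_sup.1 hr
  obtain ⟨c, rfl⟩ := Ideal.mem_span_singleton'.1 hw
  rw [mul_add]
  refine add_mem (J.mul_mem_left _ hj) ?_
  rw [mul_left_comm]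
  exact J.mul_mem_left _ hxy

end Growth

lemma HilbertGrowth.negligible {e : ℕ} {h : ℤ → ℤ} (h0 : ∀ m, 0 ≤ h m)
    (hg : HilbertGrowth (e + 1) h) (n : ℕ) : Negligible e fun _ m => h (n * m) := by
  obtain ⟨C, hC⟩ := hg
  have hN : Negligible e fun _ m => h m := by
    refine ⟨|C|, fun q hq m => ?_⟩
    rw [abs_of_nonneg (h0 m)]
    refine (hC m).trans (mul_le_mul (le_abs_self C) (pow_le_pow_left₀ (by positivity) ?_ _)
      (by positivity) (by positivity))
    have : (1 : ℤ) ≤ q := by exact_mod_cast hq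
    omega
  exact (hN.comp n 0 0 le_rfl).congr fun q m _ => by simp

section Veronese

variable {k R : Type*} [Field k] [CommRing R] [IsDomain R] [IsNoetherianRing R] [Algebra k R]
  {𝒜 : ℕ → Submodule k R} [GradedAlgebra 𝒜] {D n₀ : ℕ}

lemma negligible_finrank_sub_extendInt (h𝒜0 : 𝒜 0 ≤ Submodule.span k {1})
    (hdim : ringKrullDim R = (D + 2 : ℕ)) {a : ℤ} {x : R} (hx : x ∈ extendInt 𝒜 (n₀ * a))
    (hx0 : x ≠ 0) :
    Negligible D fun _ m => (Module.finrank k (extendInt 𝒜 (n₀ * m)) : ℤ) -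
      Module.finrank k (extendInt 𝒜 (n₀ * (m - a))) := by
  have := finiteDimensional_extendInt h𝒜0
  have hhom : (Ideal.span {x}).IsHomogeneous 𝒜 := by
    refine Ideal.homogeneous_span 𝒜 _ ?_
    rintro _ rfl
    rcases lt_or_ge ((n₀ : ℤ) * a) 0 with hz | hz
    · rw [extendInt_of_neg _ hz, Submodule.mem_bot] at hx
      exact absurd hx hx0
    · obtain ⟨l, hl⟩ := Int.eq_ofNat_of_zero_le hz
      rw [hl, extendInt_natCast] at hx
      exact ⟨l, hx⟩
  have hdimx : ringKrullDim (R ⧸ Ideal.span {x}) ≤ (D + 1 : ℕ) := by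
    have h := ringKrullDim_quotient_succ_le_of_nonZeroDivisor (mem_nonZeroDivisors_of_ne_zero hx0)
    rw [hdim] at h
    refine ENat.WithBot.add_le_add_one_right_iff.1 (h.trans (le_of_eq ?_))
    push_cast
    rw [add_assoc, one_add_one_eq_two]
  refine ((hilbertGrowth_hilb _ hhom _ hdimx).negligible (hilb_nonneg _) n₀).mono
    fun q m _ => ?_
  have h1 := hilb_le_add (J := ⊥) (K := ⊥) (Ideal.IsHomogeneous.bot 𝒜) hx
    (fun r hr => by rw [Ideal.mem_bot] at hr ⊢; rw [hr, mul_zero]) (n₀ * m)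
  have hbot : ∀ z, hilb 𝒜 ⊥ z = Module.finrank k (extendInt 𝒜 z) := by
    intro z
    have : extendInt 𝒜 z ⊓ (⊥ : Ideal R).restrictScalars k = ⊥ := by
      rw [Submodule.restrictScalars_bot, inf_bot_eq]
    rw [hilb, this, finrank_bot, Nat.cast_zero, sub_zero]
  rw [hbot, hbot, bot_sup_eq, ← mul_sub] at h1
  have h2 : Module.finrank k (extendInt 𝒜 (n₀ * (m - a))) ≤
      Module.finrank k (extendInt 𝒜 (n₀ * m)) := by
    rw [← Submodule.finrank_map_eq_of_forall (φ := Algebra.lsmul k k R x)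
      (fun v _ hv => by simpa [hx0] using hv)]
    refine Submodule.finrank_mono ?_
    rintro _ ⟨v, hv, rfl⟩
    have := gradedAction_extendInt (ℳ := 𝒜) hx hv
    rwa [← mul_add, add_sub_cancel] at this
  rw [abs_of_nonneg (by omega), abs_of_nonneg (hilb_nonneg _ _)]
  omega

omit [IsDomain R] in
lemma negligible_finrank_extendInt (h𝒜0 : 𝒜 0 ≤ Submodule.span k {1})
    (hdim : ringKrullDim R = (D + 2 : ℕ)) :
    Negligible (D + 1) fun _ m => (Module.finrank k (extendInt 𝒜 (n₀ * m)) : ℤ) := by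
  have := finiteDimensional_extendInt h𝒜0
  refine ((hilbertGrowth_hilb (⊥ : Ideal R) (Ideal.IsHomogeneous.bot 𝒜) (D + 2)
    ((ringKrullDim_le_of_surjective _ Ideal.Quotient.mk_surjective).trans hdim.le)).negligible
    (hilb_nonneg _) n₀).congr fun q m _ => ?_
  have : extendInt 𝒜 (n₀ * m) ⊓ (⊥ : Ideal R).restrictScalars k = ⊥ := by
    rw [Submodule.restrictScalars_bot, inf_bot_eq]
  rw [hilb, this, finrank_bot, Nat.cast_zero, sub_zero]

omit [IsNoetherianRing R] in
lemma exists_forall_ge_exists_ne_zero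
    (hn₀gcd : ∀ c : ℕ, (∀ m, 0 < m → 𝒜 m ≠ ⊥ → c ∣ m) → c ∣ n₀) :
    ∃ N : ℕ, ∀ m ≥ N, n₀ ∣ m → ∃ x ∈ 𝒜 m, x ≠ 0 := by
  obtain ⟨N, hN⟩ := Nat.exists_mem_closure_of_ge {m | 0 < m ∧ 𝒜 m ≠ ⊥}
  refine ⟨N, fun m hm hdvd => ?_⟩
  have hmem := hN m hm ((hn₀gcd _ fun j hj hj' =>
    Nat.setGcd_dvd_of_mem (show j ∈ {m | 0 < m ∧ 𝒜 m ≠ ⊥} from ⟨hj, hj'⟩)).trans hdvd)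
  clear hdvd hm
  induction hmem using AddSubmonoid.closure_induction with
  | mem j hj => exact (Submodule.ne_bot_iff _).1 hj.2
  | zero => exact ⟨1, SetLike.GradedOne.one_mem, one_ne_zero⟩
  | add i j _ _ hi hj =>
    obtain ⟨x, hx, hx0⟩ := hi
    obtain ⟨y, hy, hy0⟩ := hj
    exact ⟨x * y, SetLike.GradedMul.mul_mem hx hy, mul_ne_zero hx0 hy0⟩

lemma hilbertFamily_extendInt (h𝒜0 : 𝒜 0 ≤ Submodule.span k {1})
    (hdim : ringKrullDim R = (D + 2 : ℕ)) (hn₀ : 0 < n₀)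
    (hn₀gcd : ∀ c : ℕ, (∀ m, 0 < m → 𝒜 m ≠ ⊥ → c ∣ m) → c ∣ n₀) :
    HilbertFamily (fun m => extendInt 𝒜 (n₀ * m)) D where
  one_mem := by
    rw [mul_zero, ← Nat.cast_zero, extendInt_natCast]
    exact SetLike.GradedOne.one_mem
  mul_mem a b r v hr hv := by
    change r • v ∈ extendInt 𝒜 (n₀ * (a + b))
    rw [mul_add]
    exact gradedAction_extendInt hr hv
  finite m := finiteDimensional_extendInt h𝒜0 _
  growth a x hx hx0 := negligible_finrank_sub_extendInt h𝒜0 hdim hx hx0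
  consecutive := by
    obtain ⟨N, hN⟩ := exists_forall_ge_exists_ne_zero hn₀gcd
    refine ⟨N, ?_, ?_⟩
    · rw [← Nat.cast_mul, extendInt_natCast]
      exact hN _ (Nat.le_mul_of_pos_left _ hn₀) (dvd_mul_right _ _)
    · rw [← Nat.cast_succ, ← Nat.cast_mul, extendInt_natCast]
      exact hN _ (N.le_succ.trans (Nat.le_mul_of_pos_left _ hn₀)) (dvd_mul_right _ _)

end Veronese

/-! ### Finite generation of graded families -/

section Generation

variable {k R M : Type*} [Field k] [CommRing R] [Algebra k R]
  [AddCommGroup M] [Module R M] [Module k M] [IsScalarTower k R M]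
  {A : ℤ → Submodule k R} {V : ℤ → Submodule k M}

lemma genFamily_le (hV : GradedAction A V) {L : List (ℤ × M)} (hL : ∀ c ∈ L, c.2 ∈ V c.1)
    (m : ℤ) : genFamily A L m ≤ V m := by
  induction L with
  | nil => exact bot_le
  | cons c L ih =>
    obtain ⟨b, g⟩ := c
    refine sup_le (ih fun c hc => hL c (List.mem_cons_of_mem _ hc)) ?_
    rintro _ ⟨r, hr, rfl⟩
    have := hV hr (hL (b, g) List.mem_cons_self)
    rwa [sub_add_cancel] at this

lemma smul_mem_genFamily {L : List (ℤ × M)} {b m : ℤ} {g : M} (hc : (b, g) ∈ L) {r : R}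
    (hr : r ∈ A (m - b)) : r • g ∈ genFamily A L m := by
  induction L with
  | nil => simp at hc
  | cons c L ih =>
    rcases List.mem_cons.1 hc with rfl | hc
    · exact Submodule.mem_sup_right ⟨r, hr, rfl⟩
    · exact Submodule.mem_sup_left (ih hc)

/-- If `M` is finitely generated then any graded family cut out by compatible projections of `M` is
generated by finitely many homogeneous elements. -/
lemma exists_genFamily_eq [Module.Finite R M] (hV : GradedAction A V)
    (hA : ∀ r : R, ∃ (N : ℕ) (c : ℕ → R), (∀ j : ℕ, c j ∈ A j) ∧ ∑ j ∈ Finset.range N, c j = r)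
    (π : ℤ → M →+ M) (hmem : ∀ m v, π m v ∈ V m) (hid : ∀ m, ∀ v ∈ V m, π m v = v)
    (hsmul : ∀ t, ∀ r ∈ A t, ∀ m y, π m (r • y) = r • π (m - t) y)
    (hfin : ∀ y, ∃ N : ℕ, ∀ z : ℤ, N ≤ |z| → π z y = 0) :
    ∃ L : List (ℤ × M), genFamily A L = V := by
  obtain ⟨S, hS⟩ := (Module.Finite.fg_top : (⊤ : Submodule R M).FG)
  choose N hN using hfin
  set B := S.sup N
  refine ⟨(S ×ˢ Finset.Icc (-B : ℤ) B).toList.map fun c => (c.2, π c.2 c.1), funext fun m =>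
    le_antisymm (genFamily_le hV ?_ m) fun v hv => ?_⟩
  · intro c hc
    obtain ⟨c', -, rfl⟩ := List.mem_map.1 hc
    exact hmem _ _
  · obtain ⟨r, -, hr⟩ := Submodule.mem_span_finset.1 (hS ▸ Submodule.mem_top : v ∈ _)
    rw [← hid m v hv, ← hr, map_sum]
    refine Submodule.sum_mem _ fun y hy => ?_
    obtain ⟨n, c, hc, hcr⟩ := hA (r y)
    rw [← hcr, Finset.sum_smul, map_sum]
    refine Submodule.sum_mem _ fun j _ => ?_
    rw [hsmul _ _ (hc j)]
    by_cases hj : |m - (j : ℤ)| ≤ B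
    · refine smul_mem_genFamily (b := m - j) ?_ (by rw [sub_sub_cancel]; exact hc j)
      refine List.mem_map.2 ⟨(y, m - j), ?_, rfl⟩
      rw [Finset.mem_toList, Finset.mem_product, Finset.mem_Icc]
      exact ⟨hy, abs_le.1 hj⟩
    · have hy' : N y ≤ B := Finset.le_sup hy
      rw [hN y _ (by omega), smul_zero]
      exact zero_mem _

end Generation

/-! ### Frobenius bracket powers -/

section FrobeniusPow

variable {k R M ι : Type*} [Field k] [CommRing R] [Algebra k R] [AddCommGroup M] [Module R M]
  [Module k M] [IsScalarTower k R M]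

lemma Ideal.frobeniusPow_span_range {R : Type*} [CommRing R] (p : ℕ) [ExpChar R p] (f : ι → R)
    (n : ℕ) : (Ideal.span (Set.range f)).frobeniusPow (p ^ n) =
      Ideal.span (Set.range fun i => f i ^ p ^ n) := by
  have hmap : (Ideal.span (Set.range f)).map (iterateFrobenius R p n) =
      Ideal.span (Set.range fun i => f i ^ p ^ n) := by
    rw [Ideal.map_span, ← Set.range_comp]
    rfl
  refine le_antisymm (Ideal.span_le.2 ?_) (Ideal.span_mono ?_)
  · rintro _ ⟨x, hx, rfl⟩
    rw [SetLike.mem_coe, ← hmap]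
    exact Ideal.mem_map_of_mem (iterateFrobenius R p n) hx
  · rintro _ ⟨i, rfl⟩
    exact ⟨f i, Ideal.subset_span ⟨i, rfl⟩, rfl⟩

lemma finrank_quotient_comap_subtype (V N : Submodule k M) [FiniteDimensional k V] :
    (Module.finrank k (V ⧸ N.comap V.subtype) : ℤ) =
      Module.finrank k V - Module.finrank k (V ⊓ N : Submodule k M) := by
  have h1 := Submodule.finrank_quotient_add_finrank (N.comap V.subtype)
  have h2 : Module.finrank k (N.comap V.subtype) =
      Module.finrank k (V ⊓ N : Submodule k M) := by
    rw [← Submodule.map_comap_subtype]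
    exact (Submodule.finrank_map_eq_of_forall fun v _ hv => Subtype.ext hv).symm
  omega

variable {𝒜 : ℕ → Submodule k R} [GradedAlgebra 𝒜]
  {ℳ : ℕ → Submodule k M} [DirectSum.Decomposition ℳ] [SetLike.GradedSMul 𝒜 ℳ] [Fintype ι]

omit [GradedAlgebra 𝒜] in
lemma gradedPieceLen_eq_bracketLen (p : ℕ) [ExpChar R p] {n₀ : ℕ} {f : ι → R} {δ : ι → ℤ}
    (hpow : ∀ i (q : ℕ), f i ^ q ∈ extendInt 𝒜 (n₀ * (q * δ i))) (n m i : ℕ)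
    [FiniteDimensional k (extendInt ℳ (n₀ * m + i))] :
    (gradedPieceLen k ℳ (((Ideal.span (Set.range f)).frobeniusPow (p ^ n) •
        (⊤ : Submodule R M)).restrictScalars k) (m * n₀ + i) : ℤ) =
      bracketLen f δ (p ^ n) (fun z => extendInt ℳ (n₀ * z + i)) m := by
  have hV : ℳ (m * n₀ + i) = extendInt ℳ (n₀ * m + i) := by
    rw [mul_comm m, ← Nat.cast_mul, ← Nat.cast_add, extendInt_natCast]
  suffices h : extendInt ℳ (n₀ * m + i) ⊓ ((Ideal.span (Set.range f)).frobeniusPow (p ^ n) •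
      (⊤ : Submodule R M)).restrictScalars k =
        bracketPart f δ (p ^ n) (fun z => extendInt ℳ (n₀ * z + i)) m by
    rw [gradedPieceLen, hV, finrank_quotient_comap_subtype, bracketLen, h]
  rw [Ideal.frobeniusPow_span_range]
  refine le_antisymm ?_ ?_
  · rintro u ⟨hu, hu'⟩
    obtain ⟨w, hw, rfl⟩ := exists_sum_smul_of_mem_span_smul (fun i => hpow i (p ^ n)) hu hu'
    refine mem_bracketPart.2 ⟨w, fun j => ?_, rfl⟩
    convert hw j using 2
    ring
  · intro u hu
    obtain ⟨w, hw, rfl⟩ := mem_bracketPart.1 hu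
    refine Submodule.mem_inf.2 ⟨Submodule.sum_mem _ fun j _ => ?_,
      (Submodule.restrictScalars_mem k _ _).2 (Submodule.sum_mem _ fun j _ => ?_)⟩
    · have h := gradedAction_extendInt (hpow j (p ^ n)) (hw j)
      rwa [show (n₀ : ℤ) * ((p ^ n : ℕ) * δ j) + (n₀ * (m - (p ^ n : ℕ) * δ j) + i) =
        n₀ * m + i by ring] at h
    · have h : f j ^ p ^ n ∈ Ideal.span (Set.range fun i => f i ^ p ^ n) :=
        Ideal.subset_span (Set.mem_range_self j)
      exact Submodule.smul_mem_smul h (Submodule.mem_top (x := w j))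

end FrobeniusPow

/-! ### The Frobenius twist -/

section FrobeniusTwist

/-- `R` as a module over itself through the Frobenius endomorphism. -/
def FrobeniusModule (_p : ℕ) (R : Type*) : Type _ := R

namespace FrobeniusModule

instance {p : ℕ} {R : Type*} [CommRing R] : AddCommGroup (FrobeniusModule p R) :=
  inferInstanceAs (AddCommGroup R)

instance {p : ℕ} {k R : Type*} [CommRing k] [ExpChar k p] [CommRing R] [Algebra k R] :
    Module k (FrobeniusModule p R) :=
  Module.compHom R (frobenius k p)

variable {p : ℕ} {k R : Type*} [Field k] [ExpChar k p] [CommRing R] [ExpChar R p] [Algebra k R]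

variable (p R) in
/-- The identity map. -/
def equiv : FrobeniusModule p R ≃+ R := AddEquiv.refl R

lemma equiv_smul (r : R) (x : FrobeniusModule p R) :
    equiv p R (r • x) = r ^ p * equiv p R x := rfl

omit [ExpChar R p] in
lemma equiv_smul' (c : k) (x : FrobeniusModule p R) :
    equiv p R (c • x) = c ^ p • equiv p R x := rfl

instance : IsScalarTower k R (FrobeniusModule p R) where
  smul_assoc c r x := (equiv p R).injective <| by
    rw [equiv_smul, equiv_smul', equiv_smul, smul_pow, smul_mul_assoc]

/-- A subspace of `R` as a subspace of the Frobenius twist. -/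
def twist (W : Submodule k R) : Submodule k (FrobeniusModule p R) where
  carrier := {x | equiv p R x ∈ W}
  add_mem' hx hy := W.add_mem hx hy
  zero_mem' := W.zero_mem
  smul_mem' c _ hx := W.smul_mem (c ^ p) hx

omit [ExpChar R p] in
lemma mem_twist {W : Submodule k R} {x : FrobeniusModule p R} :
    x ∈ twist W ↔ equiv p R x ∈ W := Iff.rfl

omit [ExpChar R p] in
lemma finrank_twist [PerfectRing k p] (W : Submodule k R) :
    Module.finrank k (twist (p := p) W) = Module.finrank k W := by
  let j : twist (p := p) W ≃+ W :=
    { toFun := fun x => ⟨equiv p R x, x.2⟩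
      invFun := fun x => ⟨(equiv p R).symm x, x.2⟩
      left_inv := fun _ => rfl
      right_inv := fun _ => rfl
      map_add' := fun _ _ => rfl }
  exact congrArg Cardinal.toNat
    (rank_eq_of_equiv_equiv (frobenius k p) j (bijective_frobenius k p) fun _ _ => rfl)

lemma bracketPart_twist {ι : Type*} [Fintype ι] (f : ι → R) (δ : ι → ℤ) (q : ℕ)
    (A : ℤ → Submodule k R) (m : ℤ) :
    bracketPart f δ q (fun z => twist (p := p) (A (p * z))) m =
      twist (bracketPart f δ (p * q) A (p * m)) := by
  ext x
  rw [mem_twist, mem_bracketPart, mem_bracketPart]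
  have h1 : ∀ (w : ι → FrobeniusModule p R), equiv p R (∑ i, f i ^ q • w i) =
      ∑ i, f i ^ (p * q) • equiv p R (w i) := by
    intro w
    rw [map_sum]
    refine Finset.sum_congr rfl fun i _ => ?_
    rw [equiv_smul, ← pow_mul, mul_comm q p, smul_eq_mul]
  have h2 : ∀ i, (p : ℤ) * (m - q * δ i) = p * m - (p * q : ℕ) * δ i := fun i => by
    push_cast
    ring
  constructor
  · rintro ⟨w, hw, rfl⟩
    exact ⟨fun i => equiv p R (w i), fun i => by rw [← h2]; exact hw i, (h1 w).symm⟩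
  · rintro ⟨w, hw, hx⟩
    refine ⟨fun i => (equiv p R).symm (w i), fun i => ?_, (equiv p R).injective ?_⟩
    · rw [mem_twist, h2]
      exact hw i
    · rw [h1]
      exact hx

lemma bracketLen_twist [PerfectRing k p] {ι : Type*} [Fintype ι] (f : ι → R) (δ : ι → ℤ) (q : ℕ)
    (A : ℤ → Submodule k R) (m : ℤ) :
    bracketLen f δ q (fun z => twist (p := p) (A (p * z))) m =
      bracketLen f δ (p * q) A (p * m) := by
  rw [bracketLen, bracketPart_twist, finrank_twist, finrank_twist, bracketLen]

variable (p k R) in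
lemma finite [PerfectRing k p] [Algebra.FiniteType k R] :
    Module.Finite R (FrobeniusModule p R) := by
  have hft : (frobenius R p).FiniteType := by
    refine RingHom.FiniteType.of_comp_finiteType (f := algebraMap k R) ?_
    have hcomp : (frobenius R p).comp (algebraMap k R) =
        (algebraMap k R).comp (frobenius k p) := by
      ext c
      simp [frobenius_def]
    rw [hcomp]
    exact (RingHom.finiteType_algebraMap.2 inferInstance).comp
      (RingHom.FiniteType.of_surjective _ (surjective_frobenius k p))
  have hint : (frobenius R p).IsIntegral := fun x =>
    ⟨Polynomial.X ^ p - Polynomial.C x,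
      Polynomial.monic_X_pow_sub_C x (expChar_pos R p).ne', by simp [frobenius_def]⟩
  exact hint.to_finite hft

end FrobeniusModule

end FrobeniusTwist

/-! ### Vanishing in large degrees -/

section Vanishing

variable {k R M ι : Type*} [Field k] [CommRing R] [Algebra k R] [AddCommGroup M] [Module R M]
  [Module k M] [IsScalarTower k R M] [Fintype ι]
  {𝒜 : ℕ → Submodule k R} [GradedAlgebra 𝒜] {f : ι → R} {δ : ι → ℤ} {n₀ : ℕ}

lemma exists_extendInt_le {I : Ideal R} (hI : I.IsHomogeneous 𝒜) [FiniteDimensional k (R ⧸ I)] :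
    ∃ N : ℕ, ∀ z : ℤ, N ≤ z → ∀ x ∈ extendInt 𝒜 z, x ∈ I := by
  obtain ⟨S, hS⟩ := (Module.Finite.fg_top : (⊤ : Submodule k (R ⧸ I)).FG)
  choose N hN using exists_projInt_eq_zero 𝒜
  refine ⟨S.sup fun y => N y.out, fun z hz x hx => ?_⟩
  have hlin : ∀ (c : k) (y : R), projInt 𝒜 z (c • y) = c • projInt 𝒜 z y := by
    intro c y
    lift z to ℕ using by omega
    rw [projInt_natCast, projInt_natCast, DirectSum.decompose_smul]
    rfl
  obtain ⟨c, -, hc⟩ := Submodule.mem_span_finset.1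
    (hS ▸ Submodule.mem_top : Ideal.Quotient.mkₐ k I x ∈ Submodule.span k (S : Set (R ⧸ I)))
  have hmem : x - ∑ y ∈ S, c y • y.out ∈ I := by
    rw [← Ideal.Quotient.eq, ← Ideal.Quotient.mkₐ_eq_mk k, ← hc, map_sum]
    refine Finset.sum_congr rfl fun y _ => ?_
    rw [map_smul, Ideal.Quotient.mkₐ_eq_mk, Ideal.Quotient.mk_out]
  have hproj := projInt_mem_of_isHomogeneous hI hmem z
  have hzero : projInt 𝒜 z (∑ y ∈ S, c y • y.out) = 0 := by
    rw [map_sum]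
    refine Finset.sum_eq_zero fun y hy => ?_
    have : N y.out ≤ S.sup fun y => N y.out := Finset.le_sup (f := fun y => N y.out) hy
    rw [hlin, hN _ z (by omega), smul_zero]
  rwa [map_sub, hzero, sub_zero, projInt_of_mem hx] at hproj

lemma mem_span_pow_of_mem_extendInt (hf : ∀ i, f i ∈ extendInt 𝒜 (δ i)) {N : ℕ}
    (hN : ∀ z : ℤ, N ≤ z → ∀ x ∈ extendInt 𝒜 z, x ∈ Ideal.span (Set.range f))
    (hδ : ∀ i, 0 ≤ δ i) (c : ι → ℕ) (z : ℤ) (hz : N + ∑ i, c i * δ i ≤ z) {x : R}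
    (hx : x ∈ extendInt 𝒜 z) : x ∈ Ideal.span (Set.range fun i => f i ^ (c i + 1)) := by
  classical
  induction hn : ∑ i, c i generalizing c z x with
  | zero =>
    have hc : ∀ i, c i = 0 := fun i => by simpa using Finset.sum_eq_zero_iff.1 hn i
    simpa [hc] using hN z (by simpa [hc] using hz) x hx
  | succ n ih =>
    have hz' : (N : ℤ) ≤ z := by
      have : 0 ≤ ∑ i, c i * δ i := Finset.sum_nonneg fun i _ => mul_nonneg (by positivity) (hδ i)
      omega
    obtain ⟨w, hw, rfl⟩ := exists_sum_smul_of_mem_span_smul hf hx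
      (by simpa using hN z hz' x hx)
    refine Ideal.sum_mem _ fun i _ => ?_
    rw [smul_eq_mul]
    rcases Nat.eq_zero_or_pos (c i) with hi | hi
    · refine Ideal.mul_mem_right _ _ (Ideal.subset_span ⟨i, ?_⟩)
      simp [hi]
    · obtain ⟨c', rfl⟩ : ∃ c', c = c' + Pi.single i 1 := by
        refine ⟨c - Pi.single i 1, (tsub_add_cancel_of_le fun j => ?_).symm⟩
        rcases eq_or_ne j i with rfl | hj
        · simpa using Nat.one_le_iff_ne_zero.2 hi.ne'
        · simp [Pi.single_eq_of_ne hj]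
      have hsum : ∑ j, ((c' + Pi.single i 1 : ι → ℕ) j) * δ j = ∑ j, c' j * δ j + δ i := by
        simp [add_mul, Finset.sum_add_distrib, Pi.single_apply]
      have hmem := ih c' (z - δ i) (by rw [hsum] at hz; omega) (hw i) (by
        simp only [Pi.add_apply, Finset.sum_add_distrib, Finset.sum_pi_single',
          Finset.mem_univ, if_true] at hn
        omega)
      obtain ⟨b, hb⟩ := Ideal.mem_span_range_iff_exists_fun.1 hmem
      rw [← hb, Finset.mul_sum]
      refine Ideal.sum_mem _ fun j _ => ?_
      rw [mul_left_comm]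
      refine Ideal.mul_mem_left _ _ ?_
      rcases eq_or_ne j i with rfl | hj
      · refine Ideal.subset_span ⟨j, ?_⟩
        simp [pow_succ']
      · refine Ideal.mul_mem_left _ _ (Ideal.subset_span ⟨j, ?_⟩)
        simp [Pi.single_eq_of_ne hj]

lemma exists_extendInt_le_bracketPart (hn₀ : 0 < n₀) (hf : ∀ i, f i ∈ extendInt 𝒜 (n₀ * δ i))
    (hpow : ∀ i (q : ℕ), f i ^ q ∈ extendInt 𝒜 (n₀ * (q * δ i)))
    (hI : (Ideal.span (Set.range f)).IsHomogeneous 𝒜)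
    [FiniteDimensional k (R ⧸ Ideal.span (Set.range f))] (hδ : ∀ i, 0 ≤ δ i) :
    ∃ B : ℕ, ∀ q : ℕ, 1 ≤ q → ∀ m : ℤ, B * q ≤ m →
      extendInt 𝒜 (n₀ * m) ≤ bracketPart f δ q (fun j => extendInt 𝒜 (n₀ * j)) m := by
  obtain ⟨N, hN⟩ := exists_extendInt_le hI
  have hδ' : ∀ i, 0 ≤ (n₀ : ℤ) * δ i := fun i => mul_nonneg (by positivity) (hδ i)
  refine ⟨N + (∑ i, δ i).toNat, fun q hq m hm x hx => ?_⟩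
  obtain ⟨q, rfl⟩ := Nat.exists_eq_add_of_le' hq
  have hsum := Finset.sum_nonneg fun i (_ : i ∈ Finset.univ) => hδ i
  have hle : (N : ℤ) + ∑ i, q * (n₀ * δ i) ≤ n₀ * m := by
    simp only [← Finset.mul_sum]
    push_cast at hm
    rw [Int.toNat_of_nonneg hsum] at hm
    have : (1 : ℤ) ≤ n₀ := by exact_mod_cast hn₀
    have : (0 : ℤ) ≤ q := by positivity
    have h1 : N + q * ∑ i, δ i ≤ m := by nlinarith
    calc (N : ℤ) + q * (n₀ * ∑ i, δ i) ≤ n₀ * (N + q * ∑ i, δ i) := by nlinarith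
      _ ≤ n₀ * m := by gcongr
  have hmem := mem_span_pow_of_mem_extendInt hf hN hδ' (fun _ => q) _ hle hx
  obtain ⟨w, hw, rfl⟩ := exists_sum_smul_of_mem_span_smul (fun i => hpow i (q + 1)) hx
    (by simpa using hmem)
  refine mem_bracketPart.2 ⟨w, fun i => ?_, rfl⟩
  have h := hw i
  rwa [← mul_sub] at h

omit [Fintype ι] in
lemma exists_genFamily_le_bracketPart {A : ℤ → Submodule k R} {B : ℕ}
    (hB : ∀ q : ℕ, 1 ≤ q → ∀ m : ℤ, B * q ≤ m → A m ≤ bracketPart f δ q A m) (L : List (ℤ × M)) :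
    ∃ B' : ℕ, ∀ q : ℕ, 1 ≤ q → ∀ m : ℤ, B' * q ≤ m →
      genFamily A L m ≤ bracketPart f δ q (genFamily A L) m := by
  induction L with
  | nil => exact ⟨0, fun q _ m _ => bot_le⟩
  | cons c L ih =>
    obtain ⟨b, g⟩ := c
    obtain ⟨B', hB'⟩ := ih
    refine ⟨B' + B + b.natAbs, fun q hq m hm => ?_⟩
    have hq' : (1 : ℤ) ≤ q := by exact_mod_cast hq
    push_cast at hm
    have hb := abs_nonneg b
    have h1 : (B' : ℤ) * q ≤ m := by nlinarith
    have h2 : (B : ℤ) * q ≤ m - b := by nlinarith [le_abs_self b]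
    refine sup_le ((hB' q hq m h1).trans (bracketPart_mono fun j => le_sup_left)) ?_
    refine (Submodule.map_mono (hB q hq _ h2)).trans ?_
    rw [← bracketPart_map]
    exact bracketPart_mono fun j => le_sup_right

end Vanishing

section Asymptotics

variable {k : Type*} [Field k] {R : Type*} [CommRing R] [Algebra k R]
  {𝒜 : ℕ → Submodule k R} [GradedAlgebra 𝒜] {n₀ D : ℕ}

lemma exists_span_range_eq [IsNoetherianRing R] (hn₀dvd : ∀ m, 0 < m → 𝒜 m ≠ ⊥ → n₀ ∣ m)
    {I : Ideal R} (hI : I.IsHomogeneous 𝒜) :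
    ∃ (t : Finset R) (δ : t → ℤ), (∀ i, 0 ≤ δ i) ∧ (∀ i : t, (i : R) ∈ extendInt 𝒜 (n₀ * δ i)) ∧
      Ideal.span (Set.range ((↑) : t → R)) = I := by
  obtain ⟨S, rfl⟩ := (Ideal.IsHomogeneous.iff_exists 𝒜 I).1 hI
  obtain ⟨t, ht, hspan⟩ := (Submodule.fg_span_iff_fg_span_finset_subset (R := R)
    ((↑) '' S : Set R)).1 (IsNoetherian.noetherian _)
  have hdeg : ∀ x : t, ∃ j : ℤ, 0 ≤ j ∧ (x : R) ∈ extendInt 𝒜 (n₀ * j) := by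
    intro x
    obtain ⟨⟨y, j, hj⟩, -, hy⟩ := ht x.2
    rw [← hy]
    by_cases h0 : y = 0
    · exact ⟨0, le_rfl, by simp [h0]⟩
    obtain ⟨l, rfl⟩ : n₀ ∣ j := by
      rcases Nat.eq_zero_or_pos j with rfl | hpos
      · exact dvd_zero _
      · exact hn₀dvd j hpos ((Submodule.ne_bot_iff _).2 ⟨y, hj, h0⟩)
    exact ⟨l, by positivity, by rwa [← Nat.cast_mul, extendInt_natCast]⟩
  choose δ hδ hδ' using hdeg
  refine ⟨t, δ, hδ, hδ', ?_⟩
  rw [Subtype.range_coe_subtype]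
  exact hspan.symm

lemma exists_sum_eq_of_dvd (hn₀ : 0 < n₀) (hn₀dvd : ∀ m, 0 < m → 𝒜 m ≠ ⊥ → n₀ ∣ m) (r : R) :
    ∃ (N : ℕ) (c : ℕ → R), (∀ j : ℕ, c j ∈ extendInt 𝒜 (n₀ * (j : ℤ))) ∧
      ∑ j ∈ Finset.range N, c j = r := by
  obtain ⟨N, hN⟩ := exists_projInt_eq_zero 𝒜 r
  refine ⟨N, fun j => projInt 𝒜 (n₀ * (j : ℤ)) r, fun j => projInt_mem _ _ _, ?_⟩
  have hN' : ∀ z : ℤ, (n₀ * N : ℕ) ≤ z → projInt 𝒜 z r = 0 := fun z hz => by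
    refine hN z (le_trans ?_ hz)
    exact_mod_cast Nat.le_mul_of_pos_left N hn₀
  conv_rhs => rw [← sum_projInt hN']
  rw [← Finset.sum_subset (s₁ := (Finset.range N).image (n₀ * ·)) (s₂ := Finset.range (n₀ * N))
    (f := fun j : ℕ => projInt 𝒜 j r), Finset.sum_image]
  · simp
  · exact fun a _ b _ h => Nat.eq_of_mul_eq_mul_left hn₀ h
  · intro j hj
    obtain ⟨a, ha, rfl⟩ := Finset.mem_image.1 hj
    exact Finset.mem_range.2 (Nat.mul_lt_mul_of_pos_left (Finset.mem_range.1 ha) hn₀)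
  · intro j hj hj'
    by_contra h0
    have hne : 𝒜 j ≠ ⊥ := (Submodule.ne_bot_iff _).2
      ⟨_, by simpa [extendInt_natCast] using projInt_mem 𝒜 j r, h0⟩
    obtain ⟨a, rfl⟩ : n₀ ∣ j := by
      rcases Nat.eq_zero_or_pos j with rfl | hpos
      · exact dvd_zero _
      · exact hn₀dvd j hpos hne
    exact hj' (Finset.mem_image.2
      ⟨a, Finset.mem_range.2 (Nat.lt_of_mul_lt_mul_left (Finset.mem_range.1 hj)), rfl⟩)

variable (p : ℕ) [ExpChar k p] [ExpChar R p] [PerfectRing k p] [IsDomain R] [IsNoetherianRing R]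
  {ι : Type*} [Fintype ι] {f : ι → R} {δ : ι → ℤ}

omit [IsNoetherianRing R] in
/-- Comparison of colengths under the Frobenius endomorphism. -/
lemma exists_negligible_frobenius [Algebra.FiniteType k R]
    (hA : HilbertFamily (fun m => extendInt 𝒜 (n₀ * m)) D) (hn₀ : 0 < n₀)
    (hn₀dvd : ∀ m, 0 < m → 𝒜 m ≠ ⊥ → n₀ ∣ m) (hf : ∀ i, f i ∈ extendInt 𝒜 (n₀ * δ i)) :
    ∃ s : ℕ, ∀ i : ℕ, Negligible D fun q m =>
      bracketLen f δ (p * q) (fun z => extendInt 𝒜 (n₀ * z)) (p * m + i) -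
        s * bracketLen f δ q (fun z => extendInt 𝒜 (n₀ * z)) m := by
  have hp := expChar_pos R p
  have := FrobeniusModule.finite p k R
  have hV : GradedAction (fun m => extendInt 𝒜 (n₀ * m))
      fun z => FrobeniusModule.twist (p := p) (extendInt 𝒜 (n₀ * (p * z))) := by
    intro a b r v hr hv
    have h := gradedAction_extendInt (ℳ := 𝒜) (v := FrobeniusModule.equiv p R v)
      (hA.pow_mem hr p) hv
    rw [← mul_add, ← mul_add] at h
    exact h
  obtain ⟨L, hL⟩ := exists_genFamily_eq (M := FrobeniusModule p R) hV
    (exists_sum_eq_of_dvd hn₀ hn₀dvd)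
    (fun z => ((FrobeniusModule.equiv p R).symm.toAddMonoidHom.comp
      (projInt 𝒜 (n₀ * (p * z)))).comp (FrobeniusModule.equiv p R).toAddMonoidHom)
    (fun z v => projInt_mem 𝒜 _ _)
    (fun z v hv => projInt_of_mem (x := FrobeniusModule.equiv p R v) hv)
    (fun t r hr z y => by
      have h := projInt_smul (ℳ := 𝒜) (hA.pow_mem hr p) (n₀ * (p * z)) (FrobeniusModule.equiv p R y)
      rw [← mul_sub, ← mul_sub] at h
      exact h)
    (fun y => by
      obtain ⟨N, hN⟩ := exists_projInt_eq_zero 𝒜 (FrobeniusModule.equiv p R y)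
      refine ⟨N, fun z hz => ?_⟩
      have h : projInt 𝒜 (n₀ * (p * z)) (FrobeniusModule.equiv p R y) = 0 := by
        rcases lt_or_ge z 0 with hz0 | hz0
        · exact projInt_of_neg _ (mul_neg_of_pos_of_neg (by exact_mod_cast hn₀)
            (mul_neg_of_pos_of_neg (by exact_mod_cast hp) hz0)) _
        · rw [abs_of_nonneg hz0] at hz
          refine hN _ (hz.trans ?_)
          rw [← mul_assoc]
          exact le_mul_of_one_le_left hz0 (by exact_mod_cast Nat.mul_pos hn₀ hp)
      exact h)
  obtain ⟨s, hs⟩ := hA.exists_negligible_sub_mul hf L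
  refine ⟨s, fun i => ?_⟩
  rw [hL] at hs
  refine ((((hA.negligible_shift hf (-i)).comp p 0 0 hp).neg).add hs).congr fun q m _ => ?_
  rw [FrobeniusModule.bracketLen_twist f δ q (fun z => extendInt 𝒜 (n₀ * z))]
  simp only [zero_mul, add_zero, sub_neg_eq_add]
  ring

end Asymptotics

/-- Asymptotic properties of a double sequence `u q m` of colengths, which compare it with a double
sequence `w` compatible with multiplication by `p`. -/
structure ColengthPair (p D : ℕ) (w u : ℕ → ℤ → ℤ) : Prop where
  growth : Negligible (D + 1) w
  shift_one : Negligible D fun q m => w q m - w q (m - 1)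
  frobenius : ∃ s : ℕ, ∀ i : ℕ, Negligible D fun q m => w (p * q) (p * m + i) - s * w q m
  compare : ∃ s : ℕ, Negligible D fun q m => u q m - s * w q m
  vanishing : ∃ B : ℕ, ∀ q : ℕ, 1 ≤ q → ∀ m : ℤ, B * q ≤ m → w q m = 0 ∧ u q m = 0

theorem exists_colengthPair (k : Type*) [Field k] [PerfectField k] (p : ℕ) [Fact p.Prime]
    [CharP k p] (R : Type*) [CommRing R] [IsDomain R] [IsNoetherianRing R] [Algebra k R]
    [Algebra.FiniteType k R] (𝒜 : ℕ → Submodule k R) [GradedAlgebra 𝒜]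
    (h𝒜0 : 𝒜 0 ≤ Submodule.span k {1}) (D : ℕ) (hdim : ringKrullDim R = (D + 2 : ℕ))
    (I : Ideal R) (hI : I.IsHomogeneous 𝒜) (hIcolen : FiniteDimensional k (R ⧸ I))
    (n₀ : ℕ) (hn₀ : 0 < n₀) (hn₀dvd : ∀ m, 0 < m → 𝒜 m ≠ ⊥ → n₀ ∣ m)
    (hn₀gcd : ∀ c : ℕ, (∀ m, 0 < m → 𝒜 m ≠ ⊥ → c ∣ m) → c ∣ n₀)
    (M : Type*) [AddCommGroup M] [Module R M] [Module k M] [IsScalarTower k R M]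
    [Module.Finite R M] (ℳ : ℕ → Submodule k M) [DirectSum.Decomposition ℳ]
    [SetLike.GradedSMul 𝒜 ℳ] :
    ∃ w u : ℕ → ℤ → ℤ, ColengthPair p D w u ∧ ∀ n m : ℕ,
      ((∑ i ∈ Finset.range n₀, gradedPieceLen k ℳ
        ((I.frobeniusPow (p ^ n) • (⊤ : Submodule R M)).restrictScalars k) (m * n₀ + i) : ℕ) : ℤ) =
          u (p ^ n) m := by
  have : ExpChar k p := ExpChar.prime Fact.out
  have : ExpChar R p := expChar_of_injective_algebraMap (algebraMap k R).injective p
  have : PerfectRing k p := PerfectField.toPerfectRing p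
  have hA := hilbertFamily_extendInt h𝒜0 hdim hn₀ hn₀gcd
  obtain ⟨t, δ, hδ, hf, rfl⟩ := exists_span_range_eq hn₀dvd hI
  have hfin := hA.finite
  have hpow : ∀ (i : t) (q : ℕ), (i : R) ^ q ∈ extendInt 𝒜 (n₀ * (q * δ i)) :=
    fun i q => hA.pow_mem (hf i) q
  obtain ⟨B, hB⟩ := exists_extendInt_le_bracketPart hn₀ hf hpow hI hδ
  have hL : ∀ i : ℕ, ∃ L : List (ℤ × M),
      genFamily (fun z => extendInt 𝒜 (n₀ * z)) L = fun z => extendInt ℳ (n₀ * z + i) := by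
    intro i
    have hn₀' : (1 : ℤ) ≤ n₀ := by exact_mod_cast hn₀
    refine exists_genFamily_eq (fun a b r v hr hv => ?_) (exists_sum_eq_of_dvd hn₀ hn₀dvd)
      (fun z => projInt ℳ (n₀ * z + i)) (fun z v => projInt_mem ℳ _ _)
      (fun z v hv => projInt_of_mem hv) (fun a r hr z y => ?_) fun y => ?_
    · have h := gradedAction_extendInt hr hv
      rwa [← add_assoc, ← mul_add] at h
    · rw [projInt_smul hr, mul_sub, sub_add_eq_add_sub]
    · obtain ⟨N, hN⟩ := exists_projInt_eq_zero ℳ y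
      refine ⟨N + i + 1, fun z hz => ?_⟩
      push_cast at hz
      rcases lt_or_ge z 0 with hz0 | hz0
      · rw [abs_of_neg hz0] at hz
        exact projInt_of_neg _ (by nlinarith) _
      · rw [abs_of_nonneg hz0] at hz
        exact hN _ (by nlinarith)
  choose L hL using hL
  have hfinV : ∀ (i : ℕ) (z : ℤ), FiniteDimensional k (extendInt ℳ (n₀ * z + i)) := fun i z => by
    have h := hA.finite_genFamily (L i) z
    rwa [hL] at h
  choose s hs using fun i => hA.exists_negligible_sub_mul hf (L i)
  choose B' hB' using fun i => exists_genFamily_le_bracketPart hB (L i)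
  refine ⟨fun q => bracketLen (fun i : t => (i : R)) δ q (fun z => extendInt 𝒜 (n₀ * z)), fun q m =>
    ∑ i ∈ Finset.range n₀, bracketLen (fun i : t => (i : R)) δ q
      (genFamily (fun z => extendInt 𝒜 (n₀ * z)) (L i)) m, ⟨?_, ?_, ?_, ?_, ?_⟩, fun n m => ?_⟩
  · refine (negligible_finrank_extendInt (n₀ := n₀) h𝒜0 hdim).mono fun q m _ => ?_
    rw [abs_of_nonneg (bracketLen_nonneg (fun i => hpow i q) hA.mul_mem),
      abs_of_nonneg (by positivity)]
    exact bracketLen_le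
  · exact hA.negligible_shift_one hf
  · exact exists_negligible_frobenius p hA hn₀ hn₀dvd hf
  · refine ⟨∑ i ∈ Finset.range n₀, s i, (Negligible.sum (Finset.range n₀)
      fun i _ => hs i).congr fun q m _ => ?_⟩
    rw [Finset.sum_sub_distrib, Nat.cast_sum, Finset.sum_mul]
  · refine ⟨B + ∑ i ∈ Finset.range n₀, B' i, fun q hq m hm =>
      ⟨?_, Finset.sum_eq_zero fun i hi => ?_⟩⟩
    · rw [bracketLen, ← le_antisymm (hB q hq m ?_)
        (bracketPart_le (fun i => hpow i q) hA.mul_mem), sub_self]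
      refine le_trans ?_ hm
      gcongr
      omega
    · rw [bracketLen, ← le_antisymm (hB' i q hq m ?_)
        (bracketPart_le (fun i => hpow i q) (hA.gradedAction_genFamily _)), sub_self]
      refine le_trans ?_ hm
      gcongr
      have := Finset.single_le_sum (fun j _ => Nat.zero_le (B' j)) hi
      omega
  · push_cast
    refine Finset.sum_congr rfl fun i _ => ?_
    rw [hL]
    exact gradedPieceLen_eq_bracketLen p hpow n m i

/-! ### Uniform convergence -/

section Convergence

/-- A bounded sequence of functions satisfying an approximate linear recursion converges
uniformly. -/
lemma exists_tendsto_abs_sub_le {X : Type*} {F : ℕ → X → ℝ} {ρ K C r : ℝ} (hρ : 0 ≤ ρ)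
    (hr0 : 0 ≤ r) (hr : r < 1) (hK : ∀ n x, |F n x| ≤ K)
    (hF : ∀ n x, |F (n + 1) x - ρ * F n x| ≤ C * r ^ n) :
    ∃ (G : X → ℝ) (ε : ℕ → ℝ), Tendsto ε atTop (𝓝 0) ∧ ∀ n x, |F n x - G x| ≤ ε n := by
  rcases isEmpty_or_nonempty X with hX | ⟨⟨x₀⟩⟩
  · exact ⟨fun _ => 0, fun _ => 0, tendsto_const_nhds, fun _ x => hX.elim x⟩
  have hK0 : 0 ≤ K := (abs_nonneg _).trans (hK 0 x₀)
  have hC : 0 ≤ C := by simpa using (abs_nonneg _).trans (hF 0 x₀)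
  have hgeom : ∀ {t : ℝ} (c : ℝ), 0 ≤ t → t < 1 →
      Tendsto (fun n : ℕ => c * t ^ n) atTop (𝓝 0) := fun c h0 h1 => by
    simpa using (tendsto_pow_atTop_nhds_zero_of_lt_one h0 h1).const_mul c
  rcases lt_trichotomy ρ 1 with hρ1 | rfl | hρ1
  · obtain ⟨t, ht, ht1⟩ := exists_between (max_lt hρ1 hr)
    obtain ⟨hρt, hrt⟩ := max_lt_iff.1 ht
    have ht0 : 0 ≤ t := hρ.trans hρt.le
    have hpos : 0 < t - ρ := sub_pos.2 hρt
    refine ⟨0, fun n => (K + C / (t - ρ)) * t ^ n, hgeom _ ht0 ht1, fun n x => ?_⟩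
    rw [Pi.zero_apply, sub_zero]
    beta_reduce
    induction n with
    | zero =>
      rw [pow_zero, mul_one]
      exact (hK 0 x).trans (le_add_of_nonneg_right (by positivity))
    | succ n ih =>
      have h1 : |F (n + 1) x| ≤ |F (n + 1) x - ρ * F n x| + ρ * |F n x| := by
        have := abs_add_le (F (n + 1) x - ρ * F n x) (ρ * F n x)
        rwa [sub_add_cancel, abs_mul, abs_of_nonneg hρ] at this
      have h2 : C * r ^ n ≤ C * t ^ n := by gcongr
      have h3 : C / (t - ρ) * (t - ρ) = C := div_mul_cancel₀ _ hpos.ne'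
      have h4 : ρ * |F n x| ≤ ρ * ((K + C / (t - ρ)) * t ^ n) := by gcongr
      have h5 : 0 ≤ K * (t - ρ) * t ^ n := by positivity
      calc |F (n + 1) x| ≤ C * t ^ n + ρ * ((K + C / (t - ρ)) * t ^ n) := by
            linarith [hF n x]
        _ = (K + C / (t - ρ)) * t ^ (n + 1) - K * (t - ρ) * t ^ n := by
            rw [pow_succ]
            linear_combination (-t ^ n) * h3
        _ ≤ _ := by linarith
  · have hdist : ∀ x n, dist (F n x) (F (n + 1) x) ≤ C * r ^ n := fun x n => by
      rw [dist_comm, Real.dist_eq]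
      simpa using hF n x
    choose G hG using fun x => cauchySeq_tendsto_of_complete
      (cauchySeq_of_le_geometric r C hr (hdist x))
    refine ⟨G, fun n => C / (1 - r) * r ^ n, hgeom _ hr0 hr, fun n x => ?_⟩
    beta_reduce
    rw [← Real.dist_eq, div_mul_eq_mul_div]
    exact dist_le_of_le_geometric_of_tendsto r C hr (hdist x) (hG x) n
  · have hpos : 0 < ρ - 1 := sub_pos.2 hρ1
    refine ⟨0, fun n => C / (ρ - 1) * r ^ n, hgeom _ hr0 hr, fun n x => ?_⟩
    rw [Pi.zero_apply, sub_zero]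
    have hiter : ∀ j n, |F n x| ≤ K * ρ⁻¹ ^ j + C / (ρ - 1) * r ^ n := by
      intro j
      induction j with
      | zero =>
        intro n
        rw [pow_zero, mul_one]
        exact (hK n x).trans (le_add_of_nonneg_right (by positivity))
      | succ j ih =>
        intro n
        have h1 : ρ * |F n x| ≤ |F (n + 1) x| + |F (n + 1) x - ρ * F n x| := by
          have := abs_sub_abs_le_abs_sub (ρ * F n x) (F (n + 1) x)
          rw [abs_mul, abs_of_nonneg hρ, abs_sub_comm (ρ * F n x)] at this
          linarith
        have h3 : C / (ρ - 1) * (ρ - 1) = C := div_mul_cancel₀ _ hpos.ne'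
        have h4 : C / (ρ - 1) * r ^ (n + 1) ≤ C / (ρ - 1) * r ^ n :=
          mul_le_mul_of_nonneg_left (pow_le_pow_of_le_one hr0 hr.le n.le_succ) (by positivity)
        have h5 : ρ * (K * ρ⁻¹ ^ (j + 1)) = K * ρ⁻¹ ^ j := by
          rw [pow_succ]
          field_simp
        refine le_of_mul_le_mul_left ?_ (zero_lt_one.trans hρ1)
        have h6 : ρ * (C / (ρ - 1) * r ^ n) = C / (ρ - 1) * r ^ n + C * r ^ n := by
          linear_combination r ^ n * h3
        rw [mul_add, h5, h6]
        linarith [ih (n + 1), hF n x]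
    refine ge_of_tendsto' (x := atTop) ?_ fun j => hiter j n
    simpa using (hgeom K (inv_nonneg.2 hρ) (inv_lt_one_of_one_lt₀ hρ1)).add_const
      (C / (ρ - 1) * r ^ n)

lemma Negligible.exists_abs_le_mul_pow {e : ℕ} {v : ℕ → ℤ → ℤ} (hv : Negligible e v) {B : ℕ}
    (hB : ∀ q : ℕ, 1 ≤ q → ∀ m : ℤ, B * q ≤ m → v q m = 0) :
    ∃ C : ℝ, 0 ≤ C ∧ ∀ q : ℕ, 1 ≤ q → ∀ m : ℤ, 0 ≤ m → |(v q m : ℝ)| ≤ C * (q : ℝ) ^ e := by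
  obtain ⟨C, hC⟩ := hv
  have hC0 := Negligible.nonneg_const hC
  refine ⟨(C * (B + 1) ^ e : ℤ), by exact_mod_cast (by positivity), fun q hq m hm => ?_⟩
  rcases le_or_gt ((B : ℤ) * q) m with h | h
  · rw [hB q hq m h, Int.cast_zero, abs_zero]
    have : (0 : ℤ) ≤ C * (B + 1) ^ e * q ^ e := by positivity
    exact_mod_cast this
  · have h1 : |v q m| ≤ C * (B + 1) ^ e * q ^ e := by
      refine (hC q hq m).trans ?_
      rw [mul_assoc, ← mul_pow, abs_of_nonneg hm]
      gcongr
      linarith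
    exact_mod_cast h1

/-- The linear interpolation of a sequence. -/
def interpolate (a : ℕ → ℝ) (y : ℝ) : ℝ :=
  (1 - (y - ⌊y⌋₊)) * a ⌊y⌋₊ + (y - ⌊y⌋₊) * a (⌊y⌋₊ + 1)

lemma interpolate_eq (a : ℕ → ℝ) {m : ℕ} {y : ℝ} (hy : y ∈ Set.Icc (m : ℝ) (m + 1)) :
    interpolate a y = (1 - (y - m)) * a m + (y - m) * a (m + 1) := by
  rcases hy.2.eq_or_lt with rfl | hlt
  · have h : ⌊(m : ℝ) + 1⌋₊ = m + 1 := by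
      exact_mod_cast Nat.floor_natCast (R := ℝ) (m + 1)
    rw [interpolate, h]
    push_cast
    ring
  · rw [interpolate, (Nat.floor_eq_iff (m.cast_nonneg.trans hy.1)).2 ⟨hy.1, hlt⟩]

lemma continuousOn_interpolate (a : ℕ → ℝ) : ContinuousOn (interpolate a) (Set.Ici 0) := by
  have h : ∀ N : ℕ, ContinuousOn (interpolate a) (Set.Icc 0 N) := by
    intro N
    induction N with
    | zero => simp
    | succ N ih =>
      have h1 : ContinuousOn (interpolate a) (Set.Icc (N : ℝ) (N + 1)) :=
        ContinuousOn.congr (f := fun y => (1 - (y - N)) * a N + (y - N) * a (N + 1))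
          (by fun_prop) fun y hy => interpolate_eq a hy
      have h2 := ih.union_of_isClosed h1 isClosed_Icc isClosed_Icc
      rwa [Set.Icc_union_Icc_eq_Icc N.cast_nonneg (by linarith), ← Nat.cast_succ] at h2
  intro x hx
  obtain ⟨N, hN⟩ := exists_nat_gt x
  refine (h N x ⟨hx, hN.le⟩).mono_of_mem_nhdsWithin ?_
  filter_upwards [self_mem_nhdsWithin, mem_nhdsWithin_of_mem_nhds (Iio_mem_nhds hN)] with y h1 h2
  exact ⟨h1, le_of_lt h2⟩

lemma abs_interpolate_sub_le (a : ℕ → ℝ) {y : ℝ} (hy : 0 ≤ y) :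
    |interpolate a y - a ⌊y⌋₊| ≤ |a (⌊y⌋₊ + 1) - a ⌊y⌋₊| := by
  have h1 := Nat.floor_le hy
  have h2 := Nat.lt_floor_add_one y
  have h : interpolate a y - a ⌊y⌋₊ = (y - ⌊y⌋₊) * (a (⌊y⌋₊ + 1) - a ⌊y⌋₊) := by
    rw [interpolate]
    ring
  rw [h, abs_mul, abs_of_nonneg (by linarith)]
  exact mul_le_of_le_one_left (abs_nonneg _) (by linarith)

end Convergence

section Limit

namespace ColengthPair

variable {p D : ℕ} {w u : ℕ → ℤ → ℤ}

lemma exists_abs_shift_sub_le (h : ColengthPair p D w u) : ∃ C : ℝ, 0 ≤ C ∧ ∀ q : ℕ, 1 ≤ q →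
    ∀ m : ℤ, 0 ≤ m → |(w q (m + 1) : ℝ) - w q m| ≤ C * (q : ℝ) ^ D := by
  obtain ⟨B, hB⟩ := h.vanishing
  have h1 : Negligible D fun q m => w q (m + 1) - w q m :=
    (h.shift_one.shift (-1)).congr fun q m _ => by simp
  simpa using h1.exists_abs_le_mul_pow (B := B) fun q hq m hm => by
    rw [(hB q hq m hm).1, (hB q hq (m + 1) (by omega)).1, sub_zero]

lemma exists_abs_compare_sub_le (h : ColengthPair p D w u) : ∃ (s : ℕ) (C : ℝ), 0 ≤ C ∧
    ∀ q : ℕ, 1 ≤ q → ∀ m : ℤ, 0 ≤ m → |(u q m : ℝ) - s * w q m| ≤ C * (q : ℝ) ^ D := by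
  obtain ⟨B, hB⟩ := h.vanishing
  obtain ⟨s, hs⟩ := h.compare
  refine ⟨s, ?_⟩
  simpa using hs.exists_abs_le_mul_pow (B := B) fun q hq m hm => by
    rw [(hB q hq m hm).1, (hB q hq m hm).2, mul_zero, sub_zero]

lemma exists_abs_frobenius_sub_le (h : ColengthPair p D w u) (hp : 0 < p) :
    ∃ (s : ℕ) (C : ℝ), 0 ≤ C ∧ ∀ i < p, ∀ q : ℕ, 1 ≤ q → ∀ m : ℤ, 0 ≤ m →
      |(w (p * q) (p * m + i) : ℝ) - s * w q m| ≤ C * (q : ℝ) ^ D := by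
  obtain ⟨B, hB⟩ := h.vanishing
  obtain ⟨s, hs⟩ := h.frobenius
  choose C hC0 hC using fun i => (hs i).exists_abs_le_mul_pow (B := B) fun q hq m hm => by
    rw [(hB q hq m hm).1, (hB (p * q) (Nat.mul_pos hp hq) _ ?_).1, mul_zero, sub_zero]
    push_cast
    nlinarith
  refine ⟨s, ∑ i ∈ Finset.range p, C i, Finset.sum_nonneg fun i _ => hC0 i,
    fun i hi q hq m hm => ?_⟩
  have h1 := hC i q hq m hm
  push_cast at h1
  refine h1.trans ?_
  gcongr
  exact Finset.single_le_sum (f := C) (fun j _ => hC0 j) (Finset.mem_range.2 hi)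

/-- Neighbouring values of `u`, once normalized, differ by `O(q⁻¹)`. -/
lemma exists_abs_succ_sub_le (h : ColengthPair p D w u) : ∃ C : ℝ, ∀ q : ℕ, 1 ≤ q → ∀ m : ℕ,
    |(u q (m + 1 : ℕ) : ℝ) / (q : ℝ) ^ (D + 1) - u q m / (q : ℝ) ^ (D + 1)| ≤ C / q := by
  obtain ⟨C₁, hC₁, h1⟩ := h.exists_abs_shift_sub_le
  obtain ⟨s, C₂, hC₂, h2⟩ := h.exists_abs_compare_sub_le
  refine ⟨2 * C₂ + s * C₁, fun q hq m => ?_⟩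
  have hq0 : (0 : ℝ) < q := by exact_mod_cast hq
  rw [← sub_div, abs_div, abs_of_pos (by positivity : (0 : ℝ) < (q : ℝ) ^ (D + 1)),
    div_le_div_iff₀ (by positivity) hq0, pow_succ, ← mul_assoc]
  refine mul_le_mul_of_nonneg_right ?_ hq0.le
  have h3 := h1 q hq m (by positivity)
  have h4 := h2 q hq m (by positivity)
  have h5 := h2 q hq (m + 1) (by positivity)
  have h6 : |(s : ℝ) * (w q (m + 1) - w q m)| ≤ s * (C₁ * (q : ℝ) ^ D) := by
    rw [abs_mul, Nat.abs_cast]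
    gcongr
  rw [abs_le] at h4 h5 h6 ⊢
  push_cast
  constructor <;> linarith [h4.1, h4.2, h5.1, h5.2, h6.1, h6.2]

/-- The normalized values of `u` at `⌊x q⌋`, for `q` running over the powers of `p`, converge
uniformly in `x`. -/
lemma exists_tendsto_abs_sub_le (h : ColengthPair p D w u) (hp : 1 < p) :
    ∃ (G : ℝ → ℝ) (ε : ℕ → ℝ), Tendsto ε atTop (𝓝 0) ∧ ∀ n (x : ℝ),
      |(u (p ^ n) ⌊x * (p ^ n : ℕ)⌋₊ : ℝ) / ((p ^ n : ℕ) : ℝ) ^ (D + 1) - G x| ≤ ε n := by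
  obtain ⟨B, hB⟩ := h.vanishing
  obtain ⟨K, -, hK⟩ := h.growth.exists_abs_le_mul_pow (B := B) fun q hq m hm => (hB q hq m hm).1
  obtain ⟨s', C', -, hC'⟩ := h.exists_abs_compare_sub_le
  obtain ⟨s, C, -, hC⟩ := h.exists_abs_frobenius_sub_le (zero_lt_one.trans hp)
  have hp0 : (0 : ℝ) < p := by exact_mod_cast zero_lt_one.trans hp
  have hq : ∀ n, 1 ≤ p ^ n := fun n => Nat.one_le_pow _ _ (zero_lt_one.trans hp)
  have hpow : ∀ n, (0 : ℝ) < ((p ^ n : ℕ) : ℝ) := fun n => by exact_mod_cast hq n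
  have hinv : (p : ℝ)⁻¹ < 1 := inv_lt_one_of_one_lt₀ (by exact_mod_cast hp)
  obtain ⟨G, ε, hε, hG⟩ := _root_.exists_tendsto_abs_sub_le
    (F := fun n (x : ℝ) => (w (p ^ n) ⌊x * (p ^ n : ℕ)⌋₊ : ℝ) / ((p ^ n : ℕ) : ℝ) ^ (D + 1))
    (ρ := s / (p : ℝ) ^ (D + 1)) (K := K) (C := C / (p : ℝ) ^ (D + 1)) (r := (p : ℝ)⁻¹)
    (by positivity) (by positivity) hinv
    (fun n x => by
      rw [abs_div, abs_of_pos (pow_pos (hpow n) _), div_le_iff₀ (pow_pos (hpow n) _)]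
      exact hK _ (hq n) _ (by positivity))
    (fun n x => by
      set m := ⌊x * (p ^ n : ℕ)⌋₊ with hm
      have h1 : ⌊x * (p ^ (n + 1) : ℕ)⌋₊ / p = m := by
        rw [← Nat.floor_div_natCast, hm]
        congr 1
        push_cast
        field_simp
        ring
      have h2 := hC _ (Nat.mod_lt ⌊x * (p ^ (n + 1) : ℕ)⌋₊ (zero_lt_one.trans hp)) (p ^ n) (hq n) m
        (by positivity)
      rw [← pow_succ', show (p : ℤ) * m + (⌊x * (p ^ (n + 1) : ℕ)⌋₊ % p : ℕ) =
        ⌊x * (p ^ (n + 1) : ℕ)⌋₊ by rw [← h1]; exact_mod_cast Nat.div_add_mod _ _] at h2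
      have h3 : ∀ a b : ℝ, a / ((p ^ (n + 1) : ℕ) : ℝ) ^ (D + 1) -
          s / (p : ℝ) ^ (D + 1) * (b / ((p ^ n : ℕ) : ℝ) ^ (D + 1)) =
          (a - s * b) / ((p : ℝ) ^ (D + 1) * ((p ^ n : ℕ) : ℝ) ^ (D + 1)) := fun a b => by
        rw [pow_succ' p n, Nat.cast_mul, mul_pow]
        have := (hpow n).ne'
        field_simp
      have h4 := hpow n
      rw [h3, abs_div, abs_of_pos (mul_pos (pow_pos hp0 _) (pow_pos h4 _)), inv_pow,
        div_le_iff₀ (by positivity)]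
      refine h2.trans_eq ?_
      push_cast
      field_simp
      ring)
  refine ⟨fun x => s' * G x, fun n => C' * (p : ℝ)⁻¹ ^ n + s' * ε n, ?_, fun n x => ?_⟩
  · simpa using ((tendsto_pow_atTop_nhds_zero_of_lt_one (by positivity) hinv).const_mul C').add
      (hε.const_mul (s' : ℝ))
  · set m := ⌊x * (p ^ n : ℕ)⌋₊
    set Q := ((p ^ n : ℕ) : ℝ)
    have h4 := hpow n
    have h1 : |(u (p ^ n) m : ℝ) / Q ^ (D + 1) - s' * (w (p ^ n) m / Q ^ (D + 1))| ≤
        C' * (p : ℝ)⁻¹ ^ n := by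
      rw [← mul_div_assoc, ← sub_div, abs_div, abs_of_pos (pow_pos h4 _),
        div_le_iff₀ (by positivity)]
      refine (hC' _ (hq n) m (by positivity)).trans_eq ?_
      rw [pow_succ, inv_pow]
      push_cast
      field_simp
    have h2 : |(s' : ℝ) * (w (p ^ n) m / Q ^ (D + 1)) - s' * G x| ≤ s' * ε n := by
      rw [← mul_sub, abs_mul, Nat.abs_cast]
      exact mul_le_mul_of_nonneg_left (hG n x) (by positivity)
    exact (abs_sub_le _ _ _).trans (add_le_add h1 h2)

end ColengthPair

lemma tendstoUniformlyOn_of_abs_sub_le {X : Type*} {F : ℕ → X → ℝ} {G : X → ℝ} {S : Set X}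
    {ε : ℕ → ℝ} (hε : Tendsto ε atTop (𝓝 0)) (h : ∀ n, ∀ x ∈ S, |F n x - G x| ≤ ε n) :
    TendstoUniformlyOn F G atTop S := by
  rw [Metric.tendstoUniformlyOn_iff]
  intro δ hδ
  filter_upwards [hε.eventually_lt_const hδ] with n hn x hx
  rw [dist_comm, Real.dist_eq]
  exact (h n x hx).trans_lt hn

end Limit

/-- For a graded pair `(R, I)` of dimension `d ≥ 2` and a finitely
generated graded `R`-module `M`, the functions `g_n(M_R, I)` are continuous, compactly
supported and piecewise linear on `[0, ∞)`, and the sequences `{g_n(M_R, I)}` and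
`{f_n(M_R, I)}` converge uniformly on `[0, ∞)`. -/
theorem statement0
    (k : Type*) [Field k] [PerfectField k] (p : ℕ) [Fact p.Prime] [CharP k p]
    (R : Type*) [CommRing R] [IsDomain R] [IsNoetherianRing R] [Algebra k R]
    [Algebra.FiniteType k R]
    (𝒜 : ℕ → Submodule k R) [GradedAlgebra 𝒜]
    (h𝒜0 : 𝒜 0 ≤ Submodule.span k {1})
    (d : ℕ) (hd : 2 ≤ d) (hdim : ringKrullDim R = d)
    (I : Ideal R) (hI : I.IsHomogeneous 𝒜) (hIcolen : FiniteDimensional k (R ⧸ I))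
    (n₀ : ℕ) (hn₀pos : 0 < n₀)
    (hn₀dvd : ∀ m, 0 < m → 𝒜 m ≠ ⊥ → n₀ ∣ m)
    (hn₀gcd : ∀ c : ℕ, (∀ m, 0 < m → 𝒜 m ≠ ⊥ → c ∣ m) → c ∣ n₀)
    (M : Type*) [AddCommGroup M] [Module R M] [Module k M] [IsScalarTower k R M]
    [Module.Finite R M]
    (ℳ : ℕ → Submodule k M) [DirectSum.Decomposition ℳ] [SetLike.GradedSMul 𝒜 ℳ] :
    (∀ n, ContinuousOn (hkStepG k ℳ I d n₀ p n) (Set.Ici 0)) ∧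
    (∀ n, ∃ C : ℝ, 0 < C ∧ ∀ x : ℝ, C < x → hkStepG k ℳ I d n₀ p n x = 0) ∧
    (∀ n m : ℕ, ∃ a b : ℝ, ∀ x ∈ Set.Icc ((m : ℝ) / ((p ^ n : ℕ) : ℝ))
        (((m : ℝ) + 1) / ((p ^ n : ℕ) : ℝ)),
        hkStepG k ℳ I d n₀ p n x = a * x + b) ∧
    (∃ F : ℝ → ℝ, TendstoUniformlyOn (fun n => hkStepG k ℳ I d n₀ p n) F atTop (Set.Ici 0)) ∧
    (∃ F : ℝ → ℝ, TendstoUniformlyOn (fun n => hkStep k ℳ I d n₀ p n) F atTop (Set.Ici 0)) := by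
  obtain ⟨D, rfl⟩ := Nat.exists_eq_add_of_le' hd
  obtain ⟨w, u, hwu, hlen⟩ := exists_colengthPair k p R 𝒜 h𝒜0 D hdim I hI hIcolen n₀ hn₀pos
    hn₀dvd hn₀gcd M ℳ
  have hp : 1 < p := (Fact.out : p.Prime).one_lt
  have hq : ∀ n, 1 ≤ p ^ n := fun n => Nat.one_le_pow _ _ (zero_lt_one.trans hp)
  have hpos : ∀ n, (0 : ℝ) < ((p ^ n : ℕ) : ℝ) := fun n => by exact_mod_cast hq n
  let a : ℕ → ℕ → ℝ := fun n m => (u (p ^ n) m : ℝ) / ((p ^ n : ℕ) : ℝ) ^ (D + 1)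
  have hstep : ∀ n x, hkStep k ℳ I (D + 2) n₀ p n x = a n ⌊x * (p ^ n : ℕ)⌋₊ := fun n x => by
    simp only [hkStep, a]
    rw [← hlen]
    push_cast
    rfl
  have hstepG : ∀ n x, hkStepG k ℳ I (D + 2) n₀ p n x =
      interpolate (a n) (x * (p ^ n : ℕ)) := fun n x => by
    have h1 : ∀ m : ℕ, a n ⌊(m : ℝ) / (p ^ n : ℕ) * (p ^ n : ℕ)⌋₊ = a n m := fun m => by
      rw [div_mul_cancel₀ _ (hpos n).ne', Nat.floor_natCast]
    rw [hkStepG, interpolate, hstep, hstep, ← Nat.cast_succ, h1, h1]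
  obtain ⟨C, hC⟩ := hwu.exists_abs_succ_sub_le
  obtain ⟨G, ε, hε, hG⟩ := hwu.exists_tendsto_abs_sub_le hp
  obtain ⟨B, hB⟩ := hwu.vanishing
  have hlin : Tendsto (fun n : ℕ => C / ((p ^ n : ℕ) : ℝ)) atTop (𝓝 0) := by
    push_cast
    exact (tendsto_pow_atTop_atTop_of_one_lt (by exact_mod_cast hp)).const_div_atTop C
  refine ⟨fun n => ?_, fun n => ⟨B + 1, by positivity, fun x hx => ?_⟩, fun n m =>
    ⟨(p ^ n : ℕ) * (a n (m + 1) - a n m), a n m - m * (a n (m + 1) - a n m), fun x hx => ?_⟩,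
    ⟨G, tendstoUniformlyOn_of_abs_sub_le (by simpa only [add_zero] using hlin.add hε)
      fun n x hx => ?_⟩,
    ⟨G, tendstoUniformlyOn_of_abs_sub_le hε fun n x _ => ?_⟩⟩
  · rw [funext (hstepG n)]
    exact (continuousOn_interpolate _).comp (by fun_prop) fun x hx =>
      mul_nonneg hx (hpos n).le
  · have h1 : B * p ^ n ≤ ⌊x * (p ^ n : ℕ)⌋₊ := by
      refine Nat.le_floor ?_
      rw [Nat.cast_mul]
      exact mul_le_mul_of_nonneg_right (by linarith) (hpos n).le
    have h2 : ∀ m, B * p ^ n ≤ m → a n m = 0 := fun m hm => by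
      simp only [a]
      rw [(hB _ (hq n) m (by exact_mod_cast hm)).2, Int.cast_zero, zero_div]
    rw [hstepG, interpolate, h2 _ h1, h2 _ (h1.trans (Nat.le_succ _)), mul_zero, mul_zero,
      add_zero]
  · rw [hstepG, interpolate_eq (m := m)]
    · ring
    · exact ⟨(div_le_iff₀ (hpos n)).1 hx.1, (le_div_iff₀ (hpos n)).1 hx.2⟩
  · rw [hstepG]
    exact (abs_sub_le _ _ _).trans (add_le_add ((abs_interpolate_sub_le _
      (mul_nonneg hx (hpos n).le)).trans (hC _ (hq n) _)) (hG n x))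
  · rw [hstep]
    exact hG n x
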